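/- arXiv:2208.04801 — 2 statements merged into one kernel-verified Lean document; each statement's English description precedes it below -/
import Mathlib

section
/- There is a real-analytic function K on the open interval (0,2) such that for every ε with 0 < ε < 1 the following holds uniformly: for every δ > 0 there exists N such that for all n ≥ N and all integers g ≥ 0 with ε ≤ (n−2g)/ln n ≤ 2−ε, | C(n,g) / ( (√2/3)·K((n−2g)/ln n)·(ln n/(n−2g))²·6^n·((n−1)!/(n−2g)!)·(ln n)^{n−2g} ) − 1 | < δ. -/
open Filter Finset

namespace CubicMaps

open Polynomial in
/-- The polynomials `Q (n+1) = ∑ H(n,g) X^g`. -/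
noncomputable def Q : ℕ → Polynomial ℂ
  | 0 => Polynomial.C (1/2)
  | 1 => Polynomial.C 2
  | (i+2) => Polynomial.C (4*((i:ℂ)+1)*(3*i+5)*(3*i+1)/(i+2)) * (Polynomial.X * Q i)
      + Polynomial.C (4*(3*(i:ℂ)+5)/(i+2)) * ∑ k : Fin (i+2), Q k.1 * Q (i+1-k.1)
termination_by n => n
decreasing_by all_goals omega

lemma Q_rec (i : ℕ) : Q (i+2) = Polynomial.C (4*((i:ℂ)+1)*(3*i+5)*(3*i+1)/(i+2)) * (Polynomial.X * Q i)
      + Polynomial.C (4*(3*(i:ℂ)+5)/(i+2)) * ∑ k ∈ range (i+2), Q k * Q (i+1-k) := by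
  rw [Q, Finset.sum_range]

lemma sum_Icc_shift (n : ℕ) (φ : ℤ → ℚ) :
    ∑ k ∈ Finset.Icc (-1 : ℤ) ((n:ℤ)-1), φ k = ∑ k ∈ range (n+1), φ ((k:ℤ)-1) := by
  symm
  apply Finset.sum_nbij' (fun k : ℕ => (k:ℤ)-1) (fun k : ℤ => (k+1).toNat)
  · intro a ha; simp at ha ⊢; omega
  · intro a ha; simp at ha ⊢; omega
  · intro a ha; simp
  · intro a ha; simp at ha ⊢; omega
  · intro a ha; rfl

lemma sum_Icc_anti (g : ℕ) (φ : ℤ → ℤ → ℚ) :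
    ∑ k ∈ Finset.Icc (0 : ℤ) (g:ℤ), φ k (g-k) = ∑ p ∈ antidiagonal g, φ p.1 p.2 := by
  symm
  apply Finset.sum_nbij' (fun p => (p.1:ℤ)) (fun k => (k.toNat, g-k.toNat))
  · intro a ha; simp at ha ⊢; omega
  · intro a ha; simp at ha ⊢; omega
  · intro a ha; simp at ha ⊢; ext <;> simp; omega
  · intro a ha; simp at ha ⊢; omega
  · intro a ha; simp at ha; congr 1; omega

lemma Q_coeff (H : ℤ → ℤ → ℚ)
    (hH1 : ∀ g : ℤ, H (-1) g = if g = 0 then 1/2 else 0)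
    (hH2 : ∀ g : ℤ, H 0 g = if g = 0 then 2 else 0)
    (hH3 : ∀ n g : ℤ, g < 0 → H n g = 0)
    (hHrec : ∀ n g : ℤ, 1 ≤ n → 0 ≤ g →
      H n g = (4*n*(3*n+2)*(3*n-2)/(n+1)) * H (n-2) (g-1)
        + (4*(3*n+2)/(n+1)) *
          ∑ k ∈ Finset.Icc (-1 : ℤ) (n-1), ∑ i ∈ Finset.Icc (0 : ℤ) g,
            H k i * H (n-2-k) (g-i)) (j : ℕ) :
    ∀ g : ℕ, (Q j).coeff g = ((H ((j:ℤ)-1) g : ℚ) : ℂ) := by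
  induction j using Nat.strong_induction_on with
  | _ j ih =>
    intro g
    match j, ih with
    | 0, ih =>
      rw [Q, Polynomial.coeff_C]
      simp [hH1]
      split_ifs <;> simp
    | 1, ih =>
      rw [Q, Polynomial.coeff_C]
      simp [hH2]
      split_ifs <;> simp
    | (i+2), ih =>
      have h := hHrec ((i:ℤ)+1) g (by omega) (by omega)
      have e1 : (((i+2:ℕ):ℤ)-1) = (i:ℤ)+1 := by push_cast; ring
      rw [e1, h, Q_rec]
      rw [Polynomial.coeff_add, Polynomial.coeff_C_mul, Polynomial.coeff_C_mul, Polynomial.finsetSum_coeff]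
      push_cast
      congr 1
      · have e2 : (Polynomial.X * Q i).coeff g = ((H ((i:ℤ)+1-2) ((g:ℤ)-1) : ℚ) : ℂ) := by
          rcases g with _ | g
          · rw [hH3 _ _ (by simp)]; simp
          · rw [Polynomial.coeff_X_mul, ih i (by omega) g]
            rw [show (i:ℤ)+1-2 = (i:ℤ)-1 by ring, show ((g+1:ℕ):ℤ)-1 = (g:ℤ) by push_cast; ring]
        rw [e2]
        congr 1
        congr 1 <;> ring
      · have e3 : ∑ b ∈ range (i + 2), (Q b * Q (i + 1 - b)).coeff g
          = ((∑ k ∈ Finset.Icc (-1 : ℤ) ((i:ℤ)+1-1), ∑ i_1 ∈ Finset.Icc (0 : ℤ) g,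
            H k i_1 * H ((i:ℤ)+1-2-k) (g-i_1) : ℚ) : ℂ) := by
          have := sum_Icc_shift (i+1) (fun k => ∑ i_1 ∈ Finset.Icc (0 : ℤ) g,
            H k i_1 * H ((i:ℤ)+1-2-k) (g-i_1))
          push_cast at this
          rw [this]
          push_cast
          apply Finset.sum_congr rfl
          intro k hk
          simp at hk
          have := sum_Icc_anti g (fun a b => H ((k:ℤ)-1) a * H ((i:ℤ)+1-2-((k:ℤ)-1)) b)
          have h4 := congrArg (fun x : ℚ => (x:ℂ)) this
          push_cast at h4
          rw [h4, Polynomial.coeff_mul]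
          apply Finset.sum_congr rfl
          intro p hp
          rw [ih k (by omega), ih (i+1-k) (by omega)]
          rw [show ((i+1-k : ℕ):ℤ)-1 = (i:ℤ)+1-2-((k:ℤ)-1) by omega]
        rw [e3]
        push_cast
        congr 1
        congr 1 <;> ring

/-- Normalised generating function. -/
noncomputable def f (n : ℕ) (z : ℂ) : ℂ := z^n * (Q (n+1)).eval (z⁻¹^2) / (6^n * (n.factorial : ℂ))

/-- The recurrence satisfied by `f`. -/
def RecF (z : ℂ) (F : ℕ → ℂ) : Prop := ∀ i : ℕ,
  F (i+2) = ((9*((i:ℂ)+2)^2-4)/(9*((i:ℂ)+1)*((i:ℂ)+3))) * F i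
    + (2*z*(3*i+8)/(3*((i:ℂ)+2)*((i:ℂ)+3))) * F (i+1)
    + z^2*(3*(i:ℂ)+8)/(9*((i:ℂ)+3)) * ((1/(((i:ℂ)+1)*((i:ℂ)+2))) * ∑ k ∈ range (i+1),
        (1 / ((i.choose k : ℕ) : ℂ)) * (F k * F (i-k)))

lemma f_zero (z : ℂ) : f 0 z = 2 := by
  simp [f, Q]

lemma f_one (z : ℂ) (hz : z ≠ 0) : f 1 z = (20*z+5*z⁻¹)/6 := by
  have : Q 2 = _ := Q_rec 0
  simp only [f]
  norm_num
  rw [this]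
  simp [Q, Finset.sum_range_succ]
  field_simp
  norm_num
  ring

lemma f_rec (z : ℂ) (hz : z ≠ 0) : RecF z (fun n => f n z) := by
  intro i
  have hQ := Q_rec (i+1)
  rw [Finset.sum_range_succ, Finset.sum_range_succ'] at hQ
  have h0 : Q 0 = Polynomial.C (1/2) := by rw [Q]
  simp only [Nat.sub_zero, Nat.sub_self, h0] at hQ
  have e : (Q (i+3)).eval (z⁻¹^2) = (4*((i:ℂ)+2)*(3*i+8)*(3*i+4)/(i+3)) * (z⁻¹^2 * (Q (i+1)).eval (z⁻¹^2))
     + (4*(3*(i:ℂ)+8)/(i+3)) * (∑ k ∈ range (i+1), (Q (k+1)).eval (z⁻¹^2) * (Q (i-k+1)).eval (z⁻¹^2)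
        + (Q (i+2)).eval (z⁻¹^2)) := by
    rw [hQ]
    have e5 : ∑ k ∈ range (i+1), (Q (k+1)).eval (z⁻¹^2) * (Q (i+1+1-(k+1))).eval (z⁻¹^2) =
      ∑ k ∈ range (i+1), (Q (k+1)).eval (z⁻¹^2) * (Q (i-k+1)).eval (z⁻¹^2) := by
      apply Finset.sum_congr rfl
      intro k hk
      simp at hk
      rw [show i+1+1-(k+1) = i-k+1 by omega]
    simp only [Polynomial.eval_add, Polynomial.eval_mul, Polynomial.eval_C, Polynomial.eval_X, Polynomial.eval_finsetSum]
    rw [e5]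
    push_cast
    ring
  have hs : ∑ k ∈ range (i+1), (1 / ((i.choose k : ℕ) : ℂ)) * (f k z * f (i-k) z) =
      z^i / (6^i * (i.factorial:ℂ)) * ∑ k ∈ range (i+1), (Q (k+1)).eval (z⁻¹^2) * (Q (i-k+1)).eval (z⁻¹^2) := by
    rw [Finset.mul_sum]
    apply Finset.sum_congr rfl
    intro k hk
    have hk' : k ≤ i := by simp at hk; omega
    have hc := Nat.choose_mul_factorial_mul_factorial hk'
    have hc' : ((i.choose k : ℕ) : ℂ) * (k.factorial : ℂ) * ((i-k).factorial : ℂ) = (i.factorial : ℂ) := by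
      exact_mod_cast hc
    have hc0 : ((i.choose k : ℕ) : ℂ) ≠ 0 := by
      exact_mod_cast (Nat.choose_pos hk').ne'
    have hp : z^i = z^k * z^(i-k) := by rw [← pow_add]; congr 1; omega
    have hp' : (6:ℂ)^i = 6^k * 6^(i-k) := by rw [← pow_add]; congr 1; omega
    simp only [f]
    rw [← hc', hp, hp']
    have hf1 : (k.factorial : ℂ) ≠ 0 := by exact_mod_cast k.factorial_ne_zero
    have hf2 : ((i-k).factorial : ℂ) ≠ 0 := by exact_mod_cast (i-k).factorial_ne_zero
    field_simp
  simp only []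
  rw [hs]
  generalize (∑ k ∈ range (i+1), (Q (k+1)).eval (z⁻¹^2) * (Q (i-k+1)).eval (z⁻¹^2)) = S at *
  have n1 : (i:ℂ)+1 ≠ 0 := by exact_mod_cast (by omega : i+1 ≠ 0)
  have n2 : (i:ℂ)+2 ≠ 0 := by exact_mod_cast (by omega : i+2 ≠ 0)
  have n3 : (i:ℂ)+3 ≠ 0 := by exact_mod_cast (by omega : i+3 ≠ 0)
  have hf : (i.factorial : ℂ) ≠ 0 := by exact_mod_cast i.factorial_ne_zero
  simp only [f]
  rw [show i+2+1 = i+3 by ring, show i+1+1 = i+2 by ring, e]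
  rw [Nat.factorial_succ, Nat.factorial_succ]
  push_cast
  have n2' : (i:ℂ)+1+1 ≠ 0 := by rw [add_assoc]; norm_num; exact n2
  field_simp
  ring

end CubicMaps


namespace CubicMaps

lemma coef1_norm (i : ℕ) : ‖((9*((i:ℂ)+2)^2-4)/(9*((i:ℂ)+1)*((i:ℂ)+3)) - 1)‖ ≤ 1/((i:ℝ)+2)^2 := by
  have n1 : (i:ℂ)+1 ≠ 0 := by exact_mod_cast (by omega : i+1 ≠ 0)
  have n3 : (i:ℂ)+3 ≠ 0 := by exact_mod_cast (by omega : i+3 ≠ 0)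
  have : ((9*((i:ℂ)+2)^2-4)/(9*((i:ℂ)+1)*((i:ℂ)+3)) - 1) = ((5/(9*((i:ℝ)+1)*((i:ℝ)+3)) : ℝ) : ℂ) := by
    push_cast; field_simp; ring
  rw [this, Complex.norm_of_nonneg (by positivity), div_le_div_iff₀ (by positivity) (by positivity)]
  have : (0:ℝ) ≤ i := Nat.cast_nonneg i
  nlinarith

lemma coef2_norm (i : ℕ) (z : ℂ) (hz : ‖z‖ ≤ 2) :
    ‖(2*z*(3*i+8)/(3*((i:ℂ)+2)*((i:ℂ)+3))) - 2*z/((i:ℂ)+2)‖ ≤ 2/((i:ℝ)+2)^2 := by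
  have n1 : (i:ℂ)+2 ≠ 0 := by exact_mod_cast (by omega : i+2 ≠ 0)
  have n3 : (i:ℂ)+3 ≠ 0 := by exact_mod_cast (by omega : i+3 ≠ 0)
  have : (2*z*(3*i+8)/(3*((i:ℂ)+2)*((i:ℂ)+3))) - 2*z/((i:ℂ)+2) = ((-2/(3*((i:ℝ)+2)*((i:ℝ)+3)) : ℝ) : ℂ) * z := by
    push_cast; field_simp; ring
  rw [this, norm_mul, Complex.norm_real, neg_div, norm_neg, Real.norm_of_nonneg (by positivity)]
  calc 2 / (3 * ((i:ℝ) + 2) * (i + 3)) * ‖z‖ ≤ 2 / (3 * ((i:ℝ) + 2) * (i + 3)) * 2 := by gcongr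
    _ ≤ _ := by
      rw [div_mul_eq_mul_div, div_le_div_iff₀ (by positivity) (by positivity)]
      have : (0:ℝ) ≤ i := Nat.cast_nonneg i
      nlinarith

lemma coef3_norm (i : ℕ) (z : ℂ) (hz : ‖z‖ ≤ 2) (S : ℂ) :
    ‖z^2*(3*(i:ℂ)+8)/(9*((i:ℂ)+3)) * ((1/(((i:ℂ)+1)*((i:ℂ)+2))) * S)‖ ≤ 4/3/(((i:ℝ)+1)*((i:ℝ)+2)) * ‖S‖ := by
  have : z^2*(3*(i:ℂ)+8)/(9*((i:ℂ)+3)) * ((1/(((i:ℂ)+1)*((i:ℂ)+2))) * S) =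
    (((3*(i:ℝ)+8)/(9*((i:ℝ)+3)) * (1/(((i:ℝ)+1)*((i:ℝ)+2))) : ℝ) : ℂ) * (z^2 * S) := by
    push_cast; ring
  rw [this, norm_mul, Complex.norm_of_nonneg (by positivity), norm_mul, norm_pow]
  have h1 : (3*(i:ℝ)+8)/(9*((i:ℝ)+3)) ≤ 1/3 := by
    rw [div_le_div_iff₀ (by positivity) (by positivity)]; linarith
  have h2 : ‖z‖^2 ≤ 4 := by nlinarith [norm_nonneg z]
  calc (3*(i:ℝ)+8)/(9*((i:ℝ)+3)) * (1/(((i:ℝ)+1)*((i:ℝ)+2))) * (‖z‖^2*‖S‖)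
    ≤ 1/3 * (1/(((i:ℝ)+1)*((i:ℝ)+2))) * (4 * ‖S‖) := by gcongr
    _ = _ := by ring

lemma choose_mul_le (q k l : ℕ) : (q+k).choose k * (q+l).choose l ≤ (k+l).choose k * (q+(k+l)).choose (k+l) := by
  have h1 := Nat.ascFactorial_eq_factorial_mul_choose q k
  have h2 := Nat.ascFactorial_eq_factorial_mul_choose q l
  have h3 := Nat.ascFactorial_eq_factorial_mul_choose q (k+l)
  have h4 := Nat.ascFactorial_mul_ascFactorial (q+1) k l
  have h5 : (q+1).ascFactorial l ≤ (q+1+k).ascFactorial l := by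
    exact Nat.ascFactorial_le l (by omega)
  have h6 := Nat.add_choose_mul_factorial_mul_factorial k l
  have h7 : (q+1).ascFactorial k * (q+1).ascFactorial l ≤ (q+1).ascFactorial (k+l) := by
    rw [← h4]; gcongr
  rw [h1, h2, h3, ← h6] at h7
  rw [← Nat.choose_symm_add (a := k) (b := l)] at h7
  have : 0 < k.factorial * l.factorial := by positivity
  apply le_of_mul_le_mul_left _ this
  nlinarith

lemma crude (z : ℂ) (F : ℕ → ℂ) (hF : RecF z F) (hz : ‖z‖ ≤ 2) (B : ℝ) (hB : 0 ≤ B)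
    (h0 : ‖F 0‖ ≤ B) (h1 : ‖F 1‖ ≤ B) (q : ℕ) (hq : 7 + 4*B ≤ q) (n : ℕ) :
    ‖F n‖ ≤ B * ((q+n).choose n : ℝ) := by
  induction n using Nat.strong_induction_on with
  | _ n ih =>
    match n, ih with
    | 0, ih => simpa using h0
    | 1, ih =>
      simp
      nlinarith [(Nat.cast_nonneg q : (0:ℝ) ≤ q)]
    | (i+2), ih =>
      set P : ℕ → ℝ := fun n => ((q+n).choose n : ℝ) with hP
      have hsum : ‖∑ k ∈ range (i+1), (1 / ((i.choose k : ℕ) : ℂ)) * (F k * F (i-k))‖ ≤ ((i:ℝ)+1) * (B^2 * P i) := by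
        calc _ ≤ ∑ k ∈ range (i+1), B^2 * P i := by
              apply norm_sum_le_of_le
              intro k hk
              have hk' : k ≤ i := by simp at hk; omega
              rw [norm_mul, norm_mul, norm_div, norm_one, Complex.norm_natCast]
              have hc : (0:ℝ) < (i.choose k : ℝ) := by exact_mod_cast Nat.choose_pos hk'
              have c := choose_mul_le q k (i-k)
              rw [show k + (i-k) = i by omega] at c
              have c' : P k * P (i-k) ≤ (i.choose k : ℝ) * P i := by
                simp only [hP]; exact_mod_cast c
              have a1 := ih k (by omega)
              have a2 := ih (i-k) (by omega)
              rw [one_div, inv_mul_le_iff₀ hc]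
              calc ‖F k‖ * ‖F (i-k)‖ ≤ (B * P k) * (B * P (i-k)) := by gcongr
                _ = B^2 * (P k * P (i-k)) := by ring
                _ ≤ B^2 * ((i.choose k : ℝ) * P i) := by gcongr
                _ = _ := by ring
          _ = _ := by simp
      rw [hF i]
      have hi : (0:ℝ) ≤ i := Nat.cast_nonneg i
      have c1 : ‖((9*((i:ℂ)+2)^2-4)/(9*((i:ℂ)+1)*((i:ℂ)+3)))‖ ≤ 1 + 1/((i:ℝ)+2) := by
        have := coef1_norm i
        have t := norm_add_le ((9*((i:ℂ)+2)^2-4)/(9*((i:ℂ)+1)*((i:ℂ)+3)) - 1) 1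
        rw [sub_add_cancel, norm_one] at t
        have : 1/((i:ℝ)+2)^2 ≤ 1/((i:ℝ)+2) := by
          apply one_div_le_one_div_of_le <;> nlinarith
        linarith
      have c2 : ‖(2*z*(3*i+8)/(3*((i:ℂ)+2)*((i:ℂ)+3)))‖ ≤ 6/((i:ℝ)+2) := by
        have := coef2_norm i z hz
        have t := norm_add_le ((2*z*(3*i+8)/(3*((i:ℂ)+2)*((i:ℂ)+3))) - 2*z/((i:ℂ)+2)) (2*z/((i:ℂ)+2))
        rw [sub_add_cancel] at t
        have t2 : ‖2*z/((i:ℂ)+2)‖ ≤ 4/((i:ℝ)+2) := by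
          rw [norm_div, norm_mul]
          have : ‖(i:ℂ)+2‖ = (i:ℝ)+2 := by
            rw [show (i:ℂ)+2 = (((i:ℝ)+2 : ℝ) : ℂ) by push_cast; rfl, Complex.norm_of_nonneg (by positivity)]
          rw [this]
          simp
          gcongr
          linarith
        have : 2/((i:ℝ)+2)^2 ≤ 2/((i:ℝ)+2) := by
          apply div_le_div_of_nonneg_left <;> nlinarith
        have e : 6/((i:ℝ)+2) = 2/((i:ℝ)+2) + 4/((i:ℝ)+2) := by ring
        linarith
      have c3 := coef3_norm i z hz (∑ k ∈ range (i+1), (1 / ((i.choose k : ℕ) : ℂ)) * (F k * F (i-k)))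
      have a0 := ih i (by omega)
      have a1 := ih (i+1) (by omega)
      have P01 : P i ≤ P (i+1) := by
        simp only [hP]
        have : (q+i).choose i ≤ (q+(i+1)).choose (i+1) := by
          rw [← add_assoc, Nat.choose_succ_succ]; omega
        exact_mod_cast this
      have P12 : P (i+2) * ((i:ℝ)+2) = P (i+1) * (q+i+2) := by
        simp only [hP]
        have := Nat.add_one_mul_choose_eq (q+(i+1)) (i+1)
        have h2 : (q+(i+2)).choose (i+2) * (i+2) = (q+(i+1)).choose (i+1) * (q+i+2) := by
          rw [show q+(i+2) = q+(i+1)+1 by ring, show i+2 = i+1+1 by ring, ← this]; ring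
        exact_mod_cast h2
      have Pi0 : 0 ≤ P i := by simp [hP]
      have i2 : (0:ℝ) < (i:ℝ)+2 := by positivity
      calc _ ≤ (1 + 1/((i:ℝ)+2)) * (B * P i) + 6/((i:ℝ)+2) * (B * P (i+1))
            + 4/3/(((i:ℝ)+1)*((i:ℝ)+2)) * (((i:ℝ)+1) * (B^2 * P i)) := by
            refine (norm_add_le _ _).trans ?_
            refine add_le_add ((norm_add_le _ _).trans ?_) (c3.trans ?_)
            · rw [norm_mul, norm_mul]
              gcongr
            · gcongr
        _ = (1 + 1/((i:ℝ)+2)) * (B * P i) + 6/((i:ℝ)+2) * (B * P (i+1))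
            + 4/3/((i:ℝ)+2) * (B^2 * P i) := by field_simp
        _ ≤ (1 + 1/((i:ℝ)+2)) * (B * P (i+1)) + 6/((i:ℝ)+2) * (B * P (i+1))
            + 4/3/((i:ℝ)+2) * (B^2 * P (i+1)) := by gcongr
        _ = B * (P (i+1) * ((i:ℝ) + 2 + 7 + 4/3*B) / ((i:ℝ)+2)) := by field_simp; ring
        _ ≤ B * (P (i+1) * (q+i+2) / ((i:ℝ)+2)) := by
            have : 0 ≤ P (i+1) := by linarith
            apply mul_le_mul_of_nonneg_left _ hB
            apply div_le_div_of_nonneg_right _ i2.le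
            apply mul_le_mul_of_nonneg_left _ this
            linarith
        _ = B * P (i+2) := by rw [← P12]; field_simp

lemma two_pow_le_choose (k : ℕ) : ∀ N : ℕ, 2*k ≤ N → 2^k ≤ N.choose k := by
  induction k with
  | zero => intro N _; simp
  | succ k ih =>
    intro N hN
    obtain ⟨M, rfl⟩ : ∃ M, N = M+1 := ⟨N-1, by omega⟩
    have h := Nat.add_one_mul_choose_eq M k
    have h2 := ih M (by omega)
    have : 2^(k+1) * (k+1) ≤ (M+1).choose (k+1) * (k+1) := by
      rw [← h, pow_succ]
      calc 2^k*2*(k+1) = (2*(k+1)) * 2^k := by ring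
        _ ≤ (M+1) * M.choose k := by gcongr
    exact Nat.le_of_mul_le_mul_right this (by omega)

lemma sum_choose_bound (a : ℕ → ℝ) (ha : ∀ n, 0 ≤ a n) (D : ℝ) (q : ℕ) (B : ℝ) (hB : 0 ≤ B)
    (haB : ∀ n, a n ≤ B * ((q+n).choose n : ℝ))
    (hD : ∀ n, ∑ k ∈ range n, ((q+k).choose k : ℝ) * (1/2)^k ≤ D) (i : ℕ) (M : ℝ)
    (hM : ∀ j ≤ i, a j ≤ M) :
    ∑ k ∈ range (i+1), (1/((i.choose k : ℕ):ℝ)) * (a k * a (i-k)) ≤ 2 * (B * D) * M := by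
  set g : ℕ → ℝ := fun k => B * (((q+k).choose k : ℝ) * (1/2)^k) with hg
  have g0 : ∀ k, 0 ≤ g k := fun k => by simp only [hg]; positivity
  have M0 : 0 ≤ M := (ha 0).trans (hM 0 (by omega))
  have key : ∀ k l, k + l = i → k ≤ l → (1/((i.choose k : ℕ):ℝ)) * (a k * a l) ≤ g k * M := by
    intro k l hkl hle
    have h2 := two_pow_le_choose k i (by omega)
    have h2' : (2:ℝ)^k ≤ (i.choose k : ℝ) := by exact_mod_cast h2
    calc (1/((i.choose k : ℕ):ℝ)) * (a k * a l) ≤ (1/2^k) * ((B * ((q+k).choose k : ℝ)) * M) := by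
          have := haB k; have := hM l (by omega); have := ha k; have := ha l
          gcongr
      _ = _ := by simp only [hg]; rw [one_div_pow]; ring
  calc _ ≤ ∑ k ∈ range (i+1), (g k * M + g (i-k) * M) := by
        apply Finset.sum_le_sum
        intro k hk
        have hk' : k ≤ i := by simp at hk; omega
        have := mul_nonneg (g0 k) M0
        have := mul_nonneg (g0 (i-k)) M0
        rcases le_total k (i-k) with h | h
        · have := key k (i-k) (by omega) h
          linarith
        · have := key (i-k) k (by omega) h
          rw [Nat.choose_symm hk', mul_comm (a (i-k))] at this
          linarith
    _ = 2 * (B * ∑ k ∈ range (i+1), ((q+k).choose k : ℝ) * (1/2)^k) * M := by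
        rw [Finset.sum_add_distrib]
        have r := Finset.sum_range_reflect (fun k => g k * M) (i+1)
        simp only [Nat.add_sub_cancel] at r
        rw [r, ← Finset.sum_mul]
        simp only [hg]
        rw [← Finset.mul_sum]
        ring
    _ ≤ _ := by have := hD (i+1); gcongr

lemma exists_D (q : ℕ) : ∃ D : ℝ, 0 ≤ D ∧ ∀ n, ∑ k ∈ range n, ((q+k).choose k : ℝ) * (1/2)^k ≤ D := by
  have h := summable_choose_mul_geometric_of_norm_lt_one (R := ℝ) q (r := 1/2) (by norm_num [abs_lt])
  refine ⟨∑' n, ((n+q).choose q : ℝ) * (1/2)^n, tsum_nonneg (fun n => by positivity), fun n => ?_⟩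
  have h2 := h.sum_le_tsum (range n) (fun n _ => by positivity)
  refine le_trans (le_of_eq ?_) h2
  apply Finset.sum_congr rfl
  intro k _
  rw [add_comm q k, Nat.choose_symm_add]

/-- Remainder bound, uniform in `z`. -/
lemma remainder (B : ℝ) (hB : 0 ≤ B) : ∃ C : ℝ, 0 ≤ C ∧ ∀ (z : ℂ) (F : ℕ → ℂ), RecF z F → ‖z‖ ≤ 2 →
    ‖F 0‖ ≤ B → ‖F 1‖ ≤ B → (‖F 2‖ ≤ C ∧ ∀ (i : ℕ) (M : ℝ), (∀ j ≤ i+1, ‖F j‖ ≤ M) →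
      ‖F (i+2) - F i - (2*z/((i:ℂ)+2)) * F (i+1)‖ ≤ C/((i:ℝ)+2)^2 * M) := by
  obtain ⟨q, hq⟩ := exists_nat_ge (7+4*B)
  obtain ⟨D, hD0, hD⟩ := exists_D q
  refine ⟨3 + 6 * (B*D) + B * ((q+2).choose 2 : ℝ), by positivity, ?_⟩
  intro z F hF hz h0 h1
  have cr := crude z F hF hz B hB h0 h1 q hq
  constructor
  · have := cr 2
    have : 0 ≤ B*D := by positivity
    linarith
  intro i M hM
  have M0 : 0 ≤ M := (norm_nonneg _).trans (hM 0 (by omega))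
  have hs := sum_choose_bound (fun n => ‖F n‖) (fun n => norm_nonneg _) D q B hB cr hD i M (fun j hj => hM j (by omega))
  have hs' : ‖∑ k ∈ range (i+1), (1 / ((i.choose k : ℕ) : ℂ)) * (F k * F (i-k))‖ ≤ 2*(B*D)*M := by
    refine (norm_sum_le _ _).trans (le_trans (le_of_eq ?_) hs)
    apply Finset.sum_congr rfl
    intro k _
    rw [norm_mul, norm_mul, norm_div, norm_one, Complex.norm_natCast]
  have c1 := coef1_norm i
  have c2 := coef2_norm i z hz
  have c3 := coef3_norm i z hz (∑ k ∈ range (i+1), (1 / ((i.choose k : ℕ) : ℂ)) * (F k * F (i-k)))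
  have e := hF i
  set S := ∑ k ∈ range (i+1), (1 / ((i.choose k : ℕ) : ℂ)) * (F k * F (i-k))
  have e2 : F (i+2) - F i - (2*z/((i:ℂ)+2)) * F (i+1) =
    ((9*((i:ℂ)+2)^2-4)/(9*((i:ℂ)+1)*((i:ℂ)+3)) - 1) * F i
    + ((2*z*(3*i+8)/(3*((i:ℂ)+2)*((i:ℂ)+3))) - 2*z/((i:ℂ)+2)) * F (i+1)
    + z^2*(3*(i:ℂ)+8)/(9*((i:ℂ)+3)) * ((1/(((i:ℂ)+1)*((i:ℂ)+2))) * S) := by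
    rw [e]; ring
  rw [e2]
  have hi : (0:ℝ) ≤ i := Nat.cast_nonneg i
  have c4 : 4/3/(((i:ℝ)+1)*((i:ℝ)+2)) ≤ 3 / ((i:ℝ)+2)^2 := by
    rw [div_le_div_iff₀ (by positivity) (by positivity)]
    nlinarith
  calc _ ≤ 1/((i:ℝ)+2)^2 * M + 2/((i:ℝ)+2)^2 * M + 3/((i:ℝ)+2)^2 * (2*(B*D)*M) := by
        refine (norm_add_le _ _).trans ?_
        refine add_le_add ((norm_add_le _ _).trans ?_) (c3.trans ?_)
        · rw [norm_mul, norm_mul]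
          have := hM i (by omega)
          have := hM (i+1) (by omega)
          gcongr
        · gcongr
    _ = (3 + 6*(B*D)) / ((i:ℝ)+2)^2 * M := by ring
    _ ≤ _ := by
        have : 0 ≤ B * ((q+2).choose 2 : ℝ) := by positivity
        apply mul_le_mul_of_nonneg_right _ M0
        apply div_le_div_of_nonneg_right _ (by positivity)
        linarith

end CubicMaps


namespace CubicMaps

/-- log of the index -/
noncomputable def Lg (i : ℕ) : ℝ := Real.log ((i:ℝ)+2)

lemma Lg_nonneg (i : ℕ) : 0 ≤ Lg i := Real.log_nonneg (by have : (0:ℝ) ≤ i := Nat.cast_nonneg i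
                                                          linarith)

lemma Lg_succ (i : ℕ) : Lg (i+1) = Real.log ((i:ℝ)+3) := by
  unfold Lg; push_cast; ring_nf

lemma Lg_step (i : ℕ) : 1/((i:ℝ)+3) ≤ Lg (i+1) - Lg i ∧ Lg (i+1) - Lg i ≤ 1/((i:ℝ)+2) := by
  have h2 : (0:ℝ) < (i:ℝ)+2 := by positivity
  have h3 : (0:ℝ) < (i:ℝ)+3 := by positivity
  have e : Lg (i+1) - Lg i = Real.log (((i:ℝ)+3)/((i:ℝ)+2)) := by
    rw [Lg_succ, Lg, Real.log_div h3.ne' h2.ne']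
  rw [e]
  constructor
  · have := Real.one_sub_inv_le_log_of_pos (div_pos h3 h2)
    refine le_trans (le_of_eq ?_) this
    field_simp; ring
  · have := Real.log_le_sub_one_of_pos (div_pos h3 h2)
    refine this.trans (le_of_eq ?_)
    field_simp; ring

lemma inv_step (i : ℕ) : 1/((i:ℝ)+3)^2 ≤ 1/((i:ℝ)+2) - 1/((i:ℝ)+3) := by
  have h2 : (0:ℝ) < (i:ℝ)+2 := by positivity
  have h3 : (0:ℝ) < (i:ℝ)+3 := by positivity
  rw [div_sub_div _ _ h2.ne' h3.ne', div_le_div_iff₀ (by positivity) (by positivity)]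
  nlinarith

/-- comparison sequence -/
noncomputable def Eb (E s C : ℝ) (i : ℕ) : ℝ := E * Real.exp (s * Lg i + C * (1 - 1/((i:ℝ)+2)))

lemma Eb_step (E s C : ℝ) (hE : 0 ≤ E) (hs : 0 ≤ s) (hC : 0 ≤ C) (i : ℕ) :
    (1 + s/((i:ℝ)+3) + C/((i:ℝ)+3)^2) * Eb E s C i ≤ Eb E s C (i+1) := by
  have h1 := (Lg_step i).1
  have h2 := inv_step i
  unfold Eb
  have e1 : 1 + s/((i:ℝ)+3) + C/((i:ℝ)+3)^2 ≤ Real.exp (s/((i:ℝ)+3) + C/((i:ℝ)+3)^2) := by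
    have := Real.add_one_le_exp (s/((i:ℝ)+3) + C/((i:ℝ)+3)^2); linarith
  calc _ ≤ Real.exp (s/((i:ℝ)+3) + C/((i:ℝ)+3)^2) * (E * Real.exp (s * Lg i + C * (1 - 1/((i:ℝ)+2)))) := by
        gcongr
    _ = E * Real.exp (s/((i:ℝ)+3) + C/((i:ℝ)+3)^2 + (s * Lg i + C * (1 - 1/((i:ℝ)+2)))) := by
        rw [Real.exp_add (s/((i:ℝ)+3) + C/((i:ℝ)+3)^2)]; ring
    _ ≤ _ := by
        apply mul_le_mul_of_nonneg_left _ hE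
        apply Real.exp_le_exp.2
        have a1 := mul_le_mul_of_nonneg_left h1 hs
        have a2 := mul_le_mul_of_nonneg_left h2 hC
        have a3 : C/((i:ℝ)+3)^2 = C * (1/((i:ℝ)+3)^2) := by ring
        have a4 : s/((i:ℝ)+3) = s * (1/((i:ℝ)+3)) := by ring
        have a5 : (((i+1:ℕ):ℝ)+2) = (i:ℝ)+3 := by push_cast; ring
        rw [a3, a4, a5]
        linarith

lemma Eb_nonneg (E s C : ℝ) (hE : 0 ≤ E) (i : ℕ) : 0 ≤ Eb E s C i := by unfold Eb; positivity

lemma Eb_mono (E s C : ℝ) (hE : 0 ≤ E) (hs : 0 ≤ s) (hC : 0 ≤ C) : Monotone (Eb E s C) := by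
  apply monotone_nat_of_le_succ
  intro i
  refine le_trans ?_ (Eb_step E s C hE hs hC i)
  have := Eb_nonneg E s C hE i
  have : 0 ≤ s/((i:ℝ)+3) + C/((i:ℝ)+3)^2 := by positivity
  nlinarith

lemma Eb_ge (E s C : ℝ) (hE : 0 ≤ E) (hs : 0 ≤ s) (hC : 0 ≤ C) (i : ℕ) : E * Real.exp (s * Lg i) ≤ Eb E s C i := by
  unfold Eb
  apply mul_le_mul_of_nonneg_left _ hE
  apply Real.exp_le_exp.2
  have : 1/((i:ℝ)+2) ≤ 1 := by
    rw [div_le_one (by positivity)]; have : (0:ℝ) ≤ i := Nat.cast_nonneg i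
    linarith
  nlinarith

lemma Eb_ge' (E s C : ℝ) (hE : 0 ≤ E) (hs : 0 ≤ s) (hC : 0 ≤ C) (i : ℕ) : E ≤ Eb E s C i := by
  refine le_trans ?_ (Eb_ge E s C hE hs hC i)
  have : 1 ≤ Real.exp (s * Lg i) := Real.one_le_exp (mul_nonneg hs (Lg_nonneg i))
  nlinarith

lemma Eb_le (E s C : ℝ) (hE : 0 ≤ E) (hC : 0 ≤ C) (i : ℕ) :
    Eb E s C i ≤ E * Real.exp C * Real.exp (s * Lg i) := by
  unfold Eb
  rw [mul_assoc, ← Real.exp_add]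
  apply mul_le_mul_of_nonneg_left _ hE
  apply Real.exp_le_exp.2
  have : 0 ≤ 1/((i:ℝ)+2) := by positivity
  nlinarith

lemma norm_one_add_le (w : ℂ) (hw : ‖w‖ ≤ 1) : ‖1 + w‖ ≤ 1 + w.re + ‖w‖^2/2 := by
  have h1 : ‖1+w‖^2 = 1 + 2*w.re + ‖w‖^2 := by
    rw [Complex.sq_norm, Complex.sq_norm, Complex.normSq_apply, Complex.normSq_apply]
    simp; ring
  have h2 : -1 ≤ w.re := by
    have := Complex.abs_re_le_norm w
    have := abs_le.1 this
    linarith [this.1]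
  apply abs_le_of_sq_le_sq' _ _ |>.2
  · rw [h1]; nlinarith [sq_nonneg (w.re + ‖w‖^2/2)]
  · nlinarith [sq_nonneg ‖w‖]

noncomputable def Us (F : ℕ → ℂ) (i : ℕ) : ℂ := F (i+2) + F (i+1)
noncomputable def Vs (F : ℕ → ℂ) (i : ℕ) : ℂ := F (i+2) - F (i+1)
noncomputable def Gs (z : ℂ) (F : ℕ → ℂ) (i : ℕ) : ℂ := Us F i + z/(2*((i:ℂ)+2)) * Vs F i
noncomputable def Ws (z : ℂ) (F : ℕ → ℂ) (i : ℕ) : ℂ := Vs F i - z/(2*((i:ℂ)+2)) * Us F i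

lemma norm_cast_add (i : ℕ) (a : ℕ) : ‖(i:ℂ)+a‖ = (i:ℝ)+a := by
  rw [show (i:ℂ)+a = ((i+a:ℕ):ℂ) by push_cast; rfl, Complex.norm_natCast]; push_cast; rfl

lemma half_bound (z : ℂ) (hz : ‖z‖ ≤ 2) (i : ℕ) : ‖z/(2*((i:ℂ)+2))‖ ≤ 1/((i:ℝ)+2) := by
  have := norm_cast_add i 2
  push_cast at this
  rw [norm_div, norm_mul, this]
  simp
  rw [div_le_iff₀ (by positivity)]
  field_simp
  linarith

lemma UV_bound (z : ℂ) (hz : ‖z‖ ≤ 2) (F : ℕ → ℂ) (i : ℕ) (M : ℝ) (hG : ‖Gs z F i‖ ≤ M)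
    (hW : ‖Ws z F i‖ ≤ M) : ‖Us F i‖ ≤ 2*M ∧ ‖Vs F i‖ ≤ 2*M ∧ ‖F (i+2)‖ ≤ 2*M := by
  have hb := half_bound z hz i
  have hb' : 1/((i:ℝ)+2) ≤ 1/2 := by
    apply one_div_le_one_div_of_le <;> [norm_num; simp]
  set w := z/(2*((i:ℂ)+2)) with hw
  have eU : Us F i = Gs z F i - w * Vs F i := by simp only [Gs, hw]; ring
  have eV : Vs F i = Ws z F i + w * Us F i := by simp only [Ws, hw]; ring
  have a1 : ‖Us F i‖ ≤ ‖Gs z F i‖ + 1/2 * ‖Vs F i‖ := by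
    calc ‖Us F i‖ = ‖Gs z F i - w * Vs F i‖ := by rw [← eU]
      _ ≤ ‖Gs z F i‖ + ‖w * Vs F i‖ := norm_sub_le _ _
      _ ≤ _ := by rw [norm_mul]; gcongr; linarith
  have a2 : ‖Vs F i‖ ≤ ‖Ws z F i‖ + 1/2 * ‖Us F i‖ := by
    calc ‖Vs F i‖ = ‖Ws z F i + w * Us F i‖ := by rw [← eV]
      _ ≤ ‖Ws z F i‖ + ‖w * Us F i‖ := norm_add_le _ _
      _ ≤ _ := by rw [norm_mul]; gcongr; linarith
  have eF : F (i+2) = (1/2:ℂ) * (Us F i + Vs F i) := by simp only [Us, Vs]; ring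
  have a3 : ‖F (i+2)‖ ≤ 1/2 * (‖Us F i‖ + ‖Vs F i‖) := by
    rw [eF, norm_mul]
    have := norm_add_le (Us F i) (Vs F i)
    have h : ‖(1/2:ℂ)‖ = 1/2 := by norm_num
    rw [h]; linarith
  refine ⟨by linarith, by linarith, by linarith⟩

lemma small_coef (z : ℂ) (hz : ‖z‖ ≤ 2) (i : ℕ) (s : ℂ) (hs : ‖s‖ ≤ 1) :
    ‖z * (-1/(2*((i:ℂ)+2)*((i:ℂ)+3))) + s * z^2 * (1/(2*((i:ℂ)+2)*((i:ℂ)+3)^2))‖ ≤ 8/((i:ℝ)+3)^2 := by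
  have n2 := norm_cast_add i 2
  have n3 := norm_cast_add i 3
  push_cast at n2 n3
  have hi : (0:ℝ) ≤ i := Nat.cast_nonneg i
  have h2 : ‖z‖^2 ≤ 4 := by nlinarith [norm_nonneg z]
  refine (norm_add_le _ _).trans ?_
  simp only [norm_mul, norm_div, norm_neg, norm_one, norm_pow, n2, n3, Complex.norm_ofNat]
  calc ‖z‖ * (1 / (2 * ((i:ℝ) + 2) * (i + 3))) + ‖s‖ * ‖z‖^2 * (1 / (2 * ((i:ℝ) + 2) * (i + 3)^2))
    ≤ 2 * (1 / (2 * ((i:ℝ) + 2) * (i + 3))) + 1 * 4 * (1 / (2 * ((i:ℝ) + 2) * (i + 3)^2)) := by gcongr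
    _ ≤ _ := by
      rw [← sub_nonneg]
      have : 8/((i:ℝ)+3)^2 - (2 * (1 / (2 * ((i:ℝ) + 2) * (i + 3))) + 1 * 4 * (1 / (2 * ((i:ℝ) + 2) * (i + 3)^2)))
        = (8*(i+2) - (i+3) - 2)/((i+2)*((i:ℝ)+3)^2) := by field_simp; ring
      rw [this]
      apply div_nonneg _ (by positivity)
      linarith

lemma GW_step (z : ℂ) (hz : ‖z‖ ≤ 2) (F : ℕ → ℂ) (i : ℕ) (M ρ : ℝ)
    (hU : ‖Us F i‖ ≤ M) (hV : ‖Vs F i‖ ≤ M)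
    (hR : ‖F (i+3) - F (i+1) - (2*z/((i:ℂ)+3)) * F (i+2)‖ ≤ ρ) :
    ‖Gs z F (i+1) - (1 + z/((i:ℂ)+3)) * Gs z F i‖ ≤ 10/((i:ℝ)+3)^2 * M + 2 * ρ ∧
    ‖Ws z F (i+1) + (1 - z/((i:ℂ)+3)) * Ws z F i‖ ≤ 10/((i:ℝ)+3)^2 * M + 2 * ρ := by
  have n2 : (i:ℂ)+2 ≠ 0 := by exact_mod_cast (by omega : i+2 ≠ 0)
  have n3 : (i:ℂ)+3 ≠ 0 := by exact_mod_cast (by omega : i+3 ≠ 0)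
  have n3' : (i:ℂ)+1+2 ≠ 0 := by rw [add_assoc]; norm_num; exact n3
  have N3 := norm_cast_add i 3
  push_cast at N3
  have hi : (0:ℝ) ≤ i := Nat.cast_nonneg i
  set R := F (i+3) - F (i+1) - (2*z/((i:ℂ)+3)) * F (i+2) with hRdef
  have eR : F (i+3) = R + F (i+1) + (2*z/((i:ℂ)+3)) * F (i+2) := by rw [hRdef]; ring
  have c2 : ‖z^2/(2*((i:ℂ)+3)^2)‖ ≤ 2/((i:ℝ)+3)^2 := by
    have h2 : ‖z‖^2 ≤ 4 := by nlinarith [norm_nonneg z]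
    simp only [norm_mul, norm_div, norm_pow, N3, Complex.norm_ofNat]
    rw [div_le_div_iff₀ (by positivity) (by positivity)]
    nlinarith [sq_nonneg ((i:ℝ)+3)]
  have c3 : ‖z/(2*((i:ℂ)+3))‖ ≤ 1 := by
    simp only [norm_mul, norm_div, N3, Complex.norm_ofNat]
    rw [div_le_one (by positivity)]; linarith
  have M0 : 0 ≤ M := (norm_nonneg _).trans hU
  have comb : ∀ a b c x y : ℂ, ‖a‖ ≤ 8/((i:ℝ)+3)^2 → ‖b‖ ≤ 2/((i:ℝ)+3)^2 → ‖c‖ ≤ 2 → ‖x‖ ≤ M → ‖y‖ ≤ M →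
      ‖a * x + b * y + c * R‖ ≤ 10/((i:ℝ)+3)^2 * M + 2 * ρ := by
    intro a b c x y ha hb hc hx hy
    calc _ ≤ ‖a‖*‖x‖ + ‖b‖*‖y‖ + ‖c‖*‖R‖ := by
          refine (norm_add_le _ _).trans ?_
          rw [← norm_mul, ← norm_mul, ← norm_mul]
          gcongr
          exact norm_add_le _ _
      _ ≤ 8/((i:ℝ)+3)^2 * M + 2/((i:ℝ)+3)^2 * M + 2*ρ := by gcongr
      _ = _ := by ring
  constructor
  · have e : Gs z F (i+1) - (1 + z/((i:ℂ)+3)) * Gs z F i =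
      (z * (-1/(2*((i:ℂ)+2)*((i:ℂ)+3))) + (-1) * z^2 * (1/(2*((i:ℂ)+2)*((i:ℂ)+3)^2))) * Vs F i
      + z^2/(2*((i:ℂ)+3)^2) * Us F i + (1 + z/(2*((i:ℂ)+3))) * R := by
      simp only [Gs, Us, Vs]
      rw [show i+1+2 = i+3 by ring, show i+1+1 = i+2 by ring, eR]
      push_cast
      rw [show (i:ℂ)+1+2 = i+3 by ring]
      field_simp
      ring
    rw [e]
    apply comb _ _ _ _ _ (small_coef z hz i (-1) (by simp)) c2 _ hV hU
    refine (norm_add_le _ _).trans ?_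
    rw [norm_one]; linarith
  · have e : Ws z F (i+1) + (1 - z/((i:ℂ)+3)) * Ws z F i =
      (z * (-1/(2*((i:ℂ)+2)*((i:ℂ)+3))) + 1 * z^2 * (1/(2*((i:ℂ)+2)*((i:ℂ)+3)^2))) * Us F i
      + (-(z^2/(2*((i:ℂ)+3)^2))) * Vs F i + (1 - z/(2*((i:ℂ)+3))) * R := by
      simp only [Ws, Us, Vs]
      rw [show i+1+2 = i+3 by ring, show i+1+1 = i+2 by ring, eR]
      push_cast
      rw [show (i:ℂ)+1+2 = i+3 by ring]
      field_simp
      ring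
    rw [e]
    apply comb _ _ _ _ _ (small_coef z hz i 1 (by simp)) (by rw [norm_neg]; exact c2) _ hU hV
    refine (norm_sub_le _ _).trans ?_
    rw [norm_one]; linarith

end CubicMaps


namespace CubicMaps

lemma norm_one_pm (z : ℂ) (hz : ‖z‖ ≤ 2) (i : ℕ) :
    ‖1 + z/((i:ℂ)+3)‖ ≤ 1 + z.re/((i:ℝ)+3) + 2/((i:ℝ)+3)^2 ∧
    ‖1 - z/((i:ℂ)+3)‖ ≤ 1 - z.re/((i:ℝ)+3) + 2/((i:ℝ)+3)^2 := by
  have hi : (0:ℝ) ≤ i := Nat.cast_nonneg i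
  have N3 := norm_cast_add i 3
  push_cast at N3
  have hre : (z/((i:ℂ)+3)).re = z.re/((i:ℝ)+3) := by
    rw [show (i:ℂ)+3 = (((i:ℝ)+3:ℝ):ℂ) by push_cast; rfl, Complex.div_ofReal_re]
  have hn : ‖z/((i:ℂ)+3)‖ = ‖z‖/((i:ℝ)+3) := by rw [norm_div, N3]
  have h1 : ‖z/((i:ℂ)+3)‖ ≤ 1 := by
    rw [hn, div_le_one (by positivity)]; linarith
  have h2 : ‖z/((i:ℂ)+3)‖^2/2 ≤ 2/((i:ℝ)+3)^2 := by
    rw [hn, div_pow, div_div, div_le_div_iff₀ (by positivity) (by positivity)]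
    have : ‖z‖^2 ≤ 4 := by nlinarith [norm_nonneg z]
    nlinarith [sq_nonneg ((i:ℝ)+3)]
  constructor
  · have := norm_one_add_le _ h1
    rw [hre] at this; linarith
  · have := norm_one_add_le (-(z/((i:ℂ)+3))) (by rw [norm_neg]; exact h1)
    rw [Complex.neg_re, hre, norm_neg, ← sub_eq_add_neg] at this; linarith

/-- Main growth estimate. -/
lemma growth (B : ℝ) (hB : 0 ≤ B) : ∃ C E : ℝ, 0 ≤ C ∧ 0 ≤ E ∧ ∀ (z : ℂ) (F : ℕ → ℂ), RecF z F → ‖z‖ ≤ 2 →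
    0 ≤ z.re → ‖F 0‖ ≤ B → ‖F 1‖ ≤ B → ∀ i : ℕ,
      (‖Gs z F i‖ ≤ Eb E z.re C i ∧ ‖Ws z F i‖ ≤ Eb E z.re C i) ∧
      ‖Gs z F (i+1) - (1 + z/((i:ℂ)+3)) * Gs z F i‖ ≤ C/((i:ℝ)+3)^2 * Eb E z.re C i ∧
      ‖Ws z F (i+1) + (1 - z/((i:ℂ)+3)) * Ws z F i‖ ≤ C/((i:ℝ)+3)^2 * Eb E z.re C i := by
  obtain ⟨C0, hC0, hrem⟩ := remainder B hB
  refine ⟨22 + 4*C0, 2*(B+C0), by positivity, by positivity, ?_⟩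
  intro z F hF hz hre h0 h1
  obtain ⟨hF2, hrem⟩ := hrem z F hF hz h0 h1
  set C := 22 + 4*C0 with hCdef
  set E := 2*(B+C0) with hEdef
  have hC : 0 ≤ C := by positivity
  have hE : 0 ≤ E := by positivity
  have mono := Eb_mono E z.re C hE hre hC
  have stepb : ∀ i, (∀ j ≤ i, ‖Gs z F j‖ ≤ Eb E z.re C j ∧ ‖Ws z F j‖ ≤ Eb E z.re C j) →
      ‖Gs z F (i+1) - (1 + z/((i:ℂ)+3)) * Gs z F i‖ ≤ (20+4*C0)/((i:ℝ)+3)^2 * Eb E z.re C i ∧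
      ‖Ws z F (i+1) + (1 - z/((i:ℂ)+3)) * Ws z F i‖ ≤ (20+4*C0)/((i:ℝ)+3)^2 * Eb E z.re C i := by
    intro i hi
    have Ei := Eb_ge' E z.re C hE hre hC i
    have hFj : ∀ j ≤ i+1+1, ‖F j‖ ≤ 2 * Eb E z.re C i := by
      intro j hj
      match j with
      | 0 => linarith
      | 1 => linarith
      | (j+2) =>
        have := (UV_bound z hz F j _ (hi j (by omega)).1 (hi j (by omega)).2).2.2
        have := mono (show j ≤ i by omega)
        linarith
    have hR := hrem (i+1) _ hFj
    have uv := UV_bound z hz F i _ (hi i le_rfl).1 (hi i le_rfl).2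
    push_cast at hR
    rw [show (i:ℂ)+1+2 = i+3 by ring, show (i:ℝ)+1+2 = i+3 by ring] at hR
    have := GW_step z hz F i _ _ uv.1 uv.2.1 hR
    have e : 10/((i:ℝ)+3)^2 * (2*Eb E z.re C i) + 2 * (C0/((i:ℝ)+3)^2 * (2*Eb E z.re C i)) =
      (20+4*C0)/((i:ℝ)+3)^2 * Eb E z.re C i := by ring
    rw [e] at this
    exact this
  have main : ∀ i, ‖Gs z F i‖ ≤ Eb E z.re C i ∧ ‖Ws z F i‖ ≤ Eb E z.re C i := by
    intro i
    induction i using Nat.strong_induction_on with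
    | _ i ih =>
      match i, ih with
      | 0, ih =>
        have Ei := Eb_ge' E z.re C hE hre hC 0
        have hb := half_bound z hz 0
        norm_num at hb
        have hU : ‖Us F 0‖ ≤ B + C0 := by
          refine (norm_add_le _ _).trans ?_
          norm_num; linarith
        have hV : ‖Vs F 0‖ ≤ B + C0 := by
          refine (norm_sub_le _ _).trans ?_
          norm_num; linarith
        have hb1 : ‖z/(2*(((0:ℕ):ℂ)+2))‖ ≤ 1 := by
          have := half_bound z hz 0
          norm_num at this ⊢
          linarith
        constructor
        · refine (norm_add_le _ _).trans ?_
          rw [norm_mul]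
          nlinarith [norm_nonneg (Vs F 0), norm_nonneg (z/(2*(((0:ℕ):ℂ)+2)))]
        · refine (norm_sub_le _ _).trans ?_
          rw [norm_mul]
          nlinarith [norm_nonneg (Us F 0), norm_nonneg (z/(2*(((0:ℕ):ℂ)+2)))]
      | (i+1), ih =>
        have s := stepb i (fun j hj => ih j (by omega))
        have hi := ih i (by omega)
        have pm := norm_one_pm z hz i
        have es := Eb_step E z.re C hE hre hC i
        have E0 := Eb_nonneg E z.re C hE i
        have hq : 0 ≤ z.re/((i:ℝ)+3) := by positivity
        have key : ∀ a g : ℂ, ‖a‖ ≤ 1 + z.re/((i:ℝ)+3) + 2/((i:ℝ)+3)^2 → ‖g‖ ≤ Eb E z.re C i →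
            ‖a * g‖ + (20+4*C0)/((i:ℝ)+3)^2 * Eb E z.re C i ≤ Eb E z.re C (i+1) := by
          intro a g ha hg
          refine le_trans ?_ es
          rw [norm_mul]
          calc _ ≤ (1 + z.re/((i:ℝ)+3) + 2/((i:ℝ)+3)^2) * Eb E z.re C i + (20+4*C0)/((i:ℝ)+3)^2 * Eb E z.re C i := by
                gcongr
            _ = _ := by rw [hCdef]; ring
        constructor
        · have k := key _ _ pm.1 hi.1
          have t := norm_add_le (Gs z F (i+1) - (1 + z/((i:ℂ)+3)) * Gs z F i) ((1 + z/((i:ℂ)+3)) * Gs z F i)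
          rw [sub_add_cancel] at t
          linarith [s.1]
        · have k := key (1 - z/((i:ℂ)+3)) _ (by linarith [pm.2]) hi.2
          have t := norm_sub_le (Ws z F (i+1) + (1 - z/((i:ℂ)+3)) * Ws z F i) ((1 - z/((i:ℂ)+3)) * Ws z F i)
          rw [add_sub_cancel_right] at t
          linarith [s.2]
  intro i
  have s := stepb i (fun j _ => main j)
  have le : (20+4*C0)/((i:ℝ)+3)^2 * Eb E z.re C i ≤ C/((i:ℝ)+3)^2 * Eb E z.re C i := by
    have E0 := Eb_nonneg E z.re C hE i
    apply mul_le_mul_of_nonneg_right _ E0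
    apply div_le_div_of_nonneg_right _ (by positivity)
    rw [hCdef]; linarith
  exact ⟨main i, s.1.trans le, s.2.trans le⟩

lemma exp_step (z : ℂ) (hz : ‖z‖ ≤ 2) (i : ℕ) :
    ‖Complex.exp (z * ((Lg (i+1) - Lg i : ℝ) : ℂ)) - (1 + z/((i:ℂ)+3))‖ ≤ 12/((i:ℝ)+3)^2 := by
  obtain ⟨l1, l2⟩ := Lg_step i
  set l := Lg (i+1) - Lg i with hl
  have hi : (0:ℝ) ≤ i := Nat.cast_nonneg i
  have l0 : 0 ≤ l := le_trans (by positivity) l1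
  have hn : ‖z * (l:ℂ)‖ ≤ 2/((i:ℝ)+2) := by
    rw [norm_mul, Complex.norm_of_nonneg l0]
    calc _ ≤ 2 * (1/((i:ℝ)+2)) := by gcongr
      _ = _ := by ring
  have hn1 : 2/((i:ℝ)+2) ≤ 1 := by rw [div_le_one (by positivity)]; linarith
  have e := Complex.norm_exp_sub_one_sub_id_le (hn.trans hn1)
  have h2 : ‖z * (l:ℂ) - z/((i:ℂ)+3)‖ ≤ 2 * (1/((i:ℝ)+2) - 1/((i:ℝ)+3)) := by
    have : z * (l:ℂ) - z/((i:ℂ)+3) = z * ((l - 1/((i:ℝ)+3) : ℝ) : ℂ) := by push_cast; ring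
    rw [this, norm_mul, Complex.norm_of_nonneg (by linarith)]
    gcongr
  have e3 : Complex.exp (z * (l:ℂ)) - (1 + z/((i:ℂ)+3)) = (Complex.exp (z * (l:ℂ)) - 1 - z*(l:ℂ)) + (z * (l:ℂ) - z/((i:ℂ)+3)) := by ring
  rw [e3]
  refine (norm_add_le _ _).trans ?_
  have e4 : ‖z * (l:ℂ)‖^2 ≤ (2/((i:ℝ)+2))^2 := by gcongr
  have e5 : (2/((i:ℝ)+2))^2 + 2 * (1/((i:ℝ)+2) - 1/((i:ℝ)+3)) ≤ 12/((i:ℝ)+3)^2 := by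
    rw [← sub_nonneg]
    have : 12/((i:ℝ)+3)^2 - ((2/((i:ℝ)+2))^2 + 2 * (1/((i:ℝ)+2) - 1/((i:ℝ)+3))) =
      (12 * (i+2)^2 - 4*(i+3)^2 - 2 * (i+2)*(i+3))/(((i:ℝ)+3)^2*((i:ℝ)+2)^2) := by
      field_simp; ring
    rw [this]
    apply div_nonneg _ (by positivity)
    nlinarith
  linarith

lemma W_bound (C E ε : ℝ) (hC : 0 ≤ C) (hE : 0 ≤ E) (hε : 0 < ε) (hε1 : ε < 1) :
    ∃ D : ℝ, 0 ≤ D ∧ ∀ (z : ℂ) (W : ℕ → ℂ), ‖z‖ ≤ 2 → 0 ≤ z.re → ε ≤ ‖z‖ →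
      (∀ i, ‖W i‖ ≤ Eb E z.re C i) →
      (∀ i : ℕ, ‖W (i+1) + (1 - z/((i:ℂ)+3)) * W i‖ ≤ C/((i:ℝ)+3)^2 * Eb E z.re C i) →
      ∀ i, ‖W i‖ ≤ D * Real.exp ((‖z‖ - ε/2) * Lg i) := by
  set D := E * Real.exp C * Real.exp (2 * Lg 0) + C * (E * Real.exp C) * (2/ε) with hD
  have hD0 : 0 ≤ D := by positivity
  refine ⟨D * Real.exp 2, by positivity, ?_⟩
  intro z W hz hre hzε hW hstep
  set a := ‖z‖ - ε/2 with ha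
  have ha0 : ε/2 ≤ a := by linarith
  have ha0' : 0 ≤ a := by linarith
  have hzr : z.re ≤ ‖z‖ := Complex.re_le_norm z
  have main : ∀ i, ‖W i‖ ≤ Eb D a 2 i := by
    intro i
    induction i with
    | zero =>
      have h1 := hW 0
      have h2 := Eb_le E z.re C hE hC 0
      have h3 := Eb_ge' D a 2 hD0 ha0' (by norm_num) 0
      have h4 : Real.exp (z.re * Lg 0) ≤ Real.exp (2 * Lg 0) := by
        apply Real.exp_le_exp.2
        have := Lg_nonneg 0
        nlinarith
      have h5 : E * Real.exp C * Real.exp (z.re * Lg 0) ≤ E * Real.exp C * Real.exp (2 * Lg 0) := by gcongr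
      have h6 : 0 ≤ C * (E * Real.exp C) * (2/ε) := by positivity
      linarith
    | succ i ih =>
      have es := Eb_step D a 2 hD0 ha0' (by norm_num) i
      refine le_trans ?_ es
      have pm := (norm_one_pm z hz i).2
      have hq : 0 ≤ z.re/((i:ℝ)+3) := by positivity
      have t := norm_sub_le (W (i+1) + (1 - z/((i:ℂ)+3)) * W i) ((1 - z/((i:ℂ)+3)) * W i)
      rw [add_sub_cancel_right, norm_mul] at t
      have t1 : ‖1 - z/((i:ℂ)+3)‖ * ‖W i‖ ≤ (1 + 2/((i:ℝ)+3)^2) * Eb D a 2 i := by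
        gcongr
        linarith
      have i2 : (0:ℝ) < (i:ℝ)+2 := by positivity
      have t2 : C/((i:ℝ)+3)^2 * Eb E z.re C i ≤ a/((i:ℝ)+3) * Eb D a 2 i := by
        have g := Eb_ge D a 2 hD0 ha0' (by norm_num) i
        have g1 := Eb_le E z.re C hE hC i
        have g2 : Real.exp (z.re * Lg i) ≤ Real.exp (a * Lg i) * ((i:ℝ)+3) := by
          have : Real.exp (Lg i) ≤ (i:ℝ)+3 := by
            unfold Lg; rw [Real.exp_log i2]; linarith
          calc Real.exp (z.re * Lg i) ≤ Real.exp (a * Lg i + Lg i) := by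
                apply Real.exp_le_exp.2
                have := Lg_nonneg i
                nlinarith
            _ = Real.exp (a * Lg i) * Real.exp (Lg i) := Real.exp_add _ _
            _ ≤ _ := by gcongr
        have g3 : C * (E * Real.exp C) ≤ a * D := by
          have : ε/2 * (C * (E * Real.exp C) * (2/ε)) = C * (E * Real.exp C) := by field_simp
          have h7 : C * (E * Real.exp C) * (2/ε) ≤ D := by
            rw [hD]
            have : 0 ≤ E * Real.exp C * Real.exp (2 * Lg 0) := by positivity
            linarith
          rw [← this]
          gcongr
        calc C/((i:ℝ)+3)^2 * Eb E z.re C i ≤ C/((i:ℝ)+3)^2 * (E * Real.exp C * (Real.exp (a * Lg i) * ((i:ℝ)+3))) := by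
              apply mul_le_mul_of_nonneg_left _ (by positivity)
              refine g1.trans ?_
              gcongr
          _ = (C * (E * Real.exp C)) * (Real.exp (a * Lg i) / ((i:ℝ)+3)) := by field_simp
          _ ≤ (a * D) * (Real.exp (a * Lg i) / ((i:ℝ)+3)) := by gcongr
          _ = a/((i:ℝ)+3) * (D * Real.exp (a * Lg i)) := by ring
          _ ≤ _ := by gcongr
      have := hstep i
      have e : (1 + a/((i:ℝ)+3) + 2/((i:ℝ)+3)^2) * Eb D a 2 i =
        (1 + 2/((i:ℝ)+3)^2) * Eb D a 2 i + a/((i:ℝ)+3) * Eb D a 2 i := by ring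
      rw [e]
      linarith
  intro i
  exact (main i).trans (Eb_le D a 2 hD0 (by norm_num) i)

/-- The normalised sequence converging to `2 A`. -/
noncomputable def T (i : ℕ) (z : ℂ) : ℂ := Complex.exp (-(z * (Lg i : ℂ))) * Gs z (fun n => f n z) i

lemma T_prop (ε : ℝ) (hε : 0 < ε) (hε1 : ε < 1) : ∃ C : ℝ, 0 ≤ C ∧ ∀ z : ℂ, 0 ≤ z.re → ε ≤ ‖z‖ → ‖z‖ ≤ 2 →
    (∀ i j : ℕ, i ≤ j → ‖T j z - T i z‖ ≤ C/((i:ℝ)+2)) ∧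
    (∀ i : ℕ, ‖T i z‖ ≤ C) ∧
    (∀ i : ℕ, ‖f (i+2) z - 1/2 * (Complex.exp (z * (Lg i : ℂ)) * T i z)‖ ≤ C * Real.exp ((‖z‖ - ε/2) * Lg i)) := by
  obtain ⟨C, E, hC, hE, hg⟩ := growth (2 + (40+5/ε)/6) (by positivity)
  obtain ⟨D, hD, hW⟩ := W_bound C E ε hC hE hε hε1
  set A := E * Real.exp C with hA
  have hA0 : 0 ≤ A := by positivity
  refine ⟨(C+12)*A + D + 3*A, by positivity, ?_⟩
  intro z hre hzε hz
  have hz0 : z ≠ 0 := by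
    intro h; rw [h, norm_zero] at hzε; linarith
  have f0 : ‖f 0 z‖ ≤ 2 + (40+5/ε)/6 := by
    rw [f_zero]; simp; positivity
  have f1 : ‖f 1 z‖ ≤ 2 + (40+5/ε)/6 := by
    rw [f_one z hz0, norm_div]
    have h1 : ‖20*z+5*z⁻¹‖ ≤ 40 + 5/ε := by
      refine (norm_add_le _ _).trans ?_
      rw [norm_mul, norm_mul, norm_inv]
      simp only [Complex.norm_ofNat]
      have : ‖z‖⁻¹ ≤ ε⁻¹ := inv_anti₀ hε hzε
      rw [div_eq_mul_inv]
      linarith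
    simp only [Complex.norm_ofNat]
    have : ‖20*z+5*z⁻¹‖/6 ≤ (40+5/ε)/6 := by gcongr
    linarith
  have hg := hg z (fun n => f n z) (f_rec z hz0) hz hre f0 f1
  set G := Gs z (fun n => f n z) with hG
  have hW := hW z (Ws z (fun n => f n z)) hz hre hzε (fun i => (hg i).1.2) (fun i => (hg i).2.2)
  have eb := fun i => Eb_le E z.re C hE hC i
  have nexp : ∀ i, ‖Complex.exp (-(z * (Lg i : ℂ)))‖ = Real.exp (-(z.re * Lg i)) := by
    intro i; rw [Complex.norm_exp]; simp
  have stepT : ∀ i : ℕ, ‖T (i+1) z - T i z‖ ≤ (C+12)*A/((i:ℝ)+2) - (C+12)*A/((i:ℝ)+3) := by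
    intro i
    have e1 : Complex.exp (-(z * (Lg i : ℂ))) = Complex.exp (-(z * (Lg (i+1) : ℂ))) * Complex.exp (z * ((Lg (i+1) - Lg i : ℝ) : ℂ)) := by
      rw [← Complex.exp_add]; congr 1; push_cast; ring
    have e2 : T (i+1) z - T i z = Complex.exp (-(z * (Lg (i+1) : ℂ))) *
      ((G (i+1) - (1 + z/((i:ℂ)+3)) * G i) - (Complex.exp (z * ((Lg (i+1) - Lg i : ℝ) : ℂ)) - (1 + z/((i:ℂ)+3))) * G i) := by
      simp only [T]; rw [e1]; ring
    have e3 := exp_step z hz i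
    have Eb0 := Eb_nonneg E z.re C hE i
    have e4 : ‖(G (i+1) - (1 + z/((i:ℂ)+3)) * G i) - (Complex.exp (z * ((Lg (i+1) - Lg i : ℝ) : ℂ)) - (1 + z/((i:ℂ)+3))) * G i‖
       ≤ (C+12)/((i:ℝ)+3)^2 * Eb E z.re C i := by
      refine (norm_sub_le _ _).trans ?_
      rw [norm_mul]
      have h1 := (hg i).2.1
      have h2 := (hg i).1.1
      calc _ ≤ C/((i:ℝ)+3)^2 * Eb E z.re C i + 12/((i:ℝ)+3)^2 * Eb E z.re C i := by gcongr
        _ = _ := by ring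
    rw [e2, norm_mul, nexp]
    have l := (Lg_step i).1
    have l' : Lg i ≤ Lg (i+1) := by
      have : 0 ≤ 1/((i:ℝ)+3) := by positivity
      linarith
    calc _ ≤ Real.exp (-(z.re * Lg (i+1))) * ((C+12)/((i:ℝ)+3)^2 * (A * Real.exp (z.re * Lg i))) := by
          gcongr
          exact e4.trans (by gcongr; exact eb i)
      _ = (C+12)*A * (1/((i:ℝ)+3)^2) * (Real.exp (-(z.re * Lg (i+1))) * Real.exp (z.re * Lg i)) := by ring
      _ ≤ (C+12)*A * (1/((i:ℝ)+3)^2) * 1 := by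
          gcongr
          rw [← Real.exp_add]
          apply Real.exp_le_one_iff.2
          nlinarith
      _ ≤ (C+12)*A * (1/((i:ℝ)+2) - 1/((i:ℝ)+3)) := by
          rw [mul_one]
          exact mul_le_mul_of_nonneg_left (inv_step i) (by positivity)
      _ = _ := by ring
  have cauchy : ∀ i k : ℕ, ‖T (i+k) z - T i z‖ ≤ (C+12)*A/((i:ℝ)+2) - (C+12)*A/((i:ℝ)+k+2) := by
    intro i k
    induction k with
    | zero => simp
    | succ k ih =>
      have s := stepT (i+k)
      push_cast at s ⊢
      rw [show (i:ℝ)+((k:ℝ)+1)+2 = i+k+3 by ring]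
      have := norm_add_le (T (i+k+1) z - T (i+k) z) (T (i+k) z - T i z)
      rw [sub_add_sub_cancel] at this
      rw [← add_assoc i k 1]
      linarith
  have Tb : ∀ i, ‖T i z‖ ≤ A := by
    intro i
    simp only [T]
    rw [norm_mul, nexp]
    have h2 := ((hg i).1.1).trans (eb i)
    calc _ ≤ Real.exp (-(z.re * Lg i)) * (A * Real.exp (z.re * Lg i)) := by gcongr
      _ = A * (Real.exp (-(z.re * Lg i)) * Real.exp (z.re * Lg i)) := by ring
      _ = A := by rw [← Real.exp_add]; simp
  refine ⟨?_, ?_, ?_⟩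
  · intro i j hij
    obtain ⟨k, rfl⟩ := Nat.exists_eq_add_of_le hij
    refine (cauchy i k).trans ?_
    have h1 : 0 ≤ (C+12)*A/((i:ℝ)+k+2) := by positivity
    have h2 : (C+12)*A/((i:ℝ)+2) ≤ ((C+12)*A + D + 3*A)/((i:ℝ)+2) := by
      apply div_le_div_of_nonneg_right _ (by positivity)
      linarith
    linarith
  · intro i
    have := Tb i
    have : 0 ≤ (C+12)*A := by positivity
    linarith
  · intro i
    have i2 : (0:ℝ) < (i:ℝ)+2 := by positivity
    have eT : Complex.exp (z * (Lg i : ℂ)) * T i z = G i := by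
      simp only [T]
      rw [← mul_assoc, ← Complex.exp_add]; simp [hG]
    rw [eT]
    set w := z/(2*((i:ℂ)+2)) with hw
    have hwn : ‖w‖ ≤ 1/((i:ℝ)+2) := half_bound z hz i
    set u := Us (fun n => f n z) i with hu
    set v := Vs (fun n => f n z) i with hv
    have eW : v = Ws z (fun n => f n z) i + w * u := by simp only [Ws, hw, hu, hv]; ring
    have e : f (i+2) z - 1/2 * G i = 1/2 * (1 - w) * v := by
      have : f (i+2) z = 1/2 * (u + v) := by simp only [hu, hv, Us, Vs]; ring
      rw [this]; simp only [hG, Gs]; rw [← hu, ← hv, ← hw]; ring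
    have uv := UV_bound z hz _ i _ (hg i).1.1 (hg i).1.2
    have hu' : ‖u‖ ≤ 2 * (A * Real.exp (z.re * Lg i)) := uv.1.trans (by have := eb i; linarith)
    have hzr : z.re ≤ ‖z‖ := Complex.re_le_norm z
    have hwu : ‖w * u‖ ≤ 2 * A * Real.exp ((‖z‖ - ε/2) * Lg i) := by
      rw [norm_mul]
      calc ‖w‖ * ‖u‖ ≤ 1/((i:ℝ)+2) * (2 * (A * Real.exp (z.re * Lg i))) := by gcongr
        _ = 2 * A * (Real.exp (-Lg i) * Real.exp (z.re * Lg i)) := by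
            rw [Real.exp_neg, Lg, Real.exp_log i2]; ring
        _ ≤ _ := by
            rw [← Real.exp_add]
            gcongr
            have := Lg_nonneg i
            nlinarith
    have hv' : ‖v‖ ≤ (D + 2 * A) * Real.exp ((‖z‖ - ε/2) * Lg i) := by
      rw [eW]
      refine (norm_add_le _ _).trans ?_
      have := hW i
      linarith
    rw [e, norm_mul, norm_mul]
    have h1w : ‖1 - w‖ ≤ 2 := by
      refine (norm_sub_le _ _).trans ?_
      have : 1/((i:ℝ)+2) ≤ 1 := by
        rw [div_le_one i2]; have : (0:ℝ) ≤ i := Nat.cast_nonneg i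
        linarith
      rw [norm_one]; linarith
    have hh : ‖(1/2:ℂ)‖ = 1/2 := by norm_num
    rw [hh]
    calc 1/2 * ‖1-w‖ * ‖v‖ ≤ 1/2 * 2 * ((D + 2 * A) * Real.exp ((‖z‖ - ε/2) * Lg i)) := by gcongr
      _ = (D + 2 * A) * Real.exp ((‖z‖ - ε/2) * Lg i) := by ring
      _ ≤ _ := by
        apply mul_le_mul_of_nonneg_right _ (Real.exp_pos _).le
        have : 0 ≤ (C+12)*A := by positivity
        linarith

end CubicMaps

namespace CubicMaps

noncomputable def A (z : ℂ) : ℂ := limUnder atTop (fun i => (1/2) * T i z)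

lemma exp_neg_Lg (i : ℕ) : Real.exp (-Lg i) = 1/((i:ℝ)+2) := by
  unfold Lg
  rw [Real.exp_neg, Real.exp_log (by positivity), one_div]

lemma tendsto_inv_shift (C : ℝ) : Tendsto (fun i : ℕ => C/((i:ℝ)+2)) atTop (nhds 0) := by
  have h : Tendsto (fun i : ℕ => (i:ℝ)+2) atTop atTop :=
    tendsto_atTop_add_const_right _ _ tendsto_natCast_atTop_atTop
  exact h.const_div_atTop C

lemma tendsto_Lg : Tendsto Lg atTop atTop := by
  have h : Tendsto (fun i : ℕ => (i:ℝ)+2) atTop atTop :=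
    tendsto_atTop_add_const_right _ _ tendsto_natCast_atTop_atTop
  exact Real.tendsto_log_atTop.comp h

lemma A_prop (ε : ℝ) (hε : 0 < ε) (hε1 : ε < 1) : ∃ C : ℝ, 0 ≤ C ∧ ∀ z : ℂ, 0 ≤ z.re → ε ≤ ‖z‖ → ‖z‖ ≤ 2 →
    (∀ i, ‖A z - 1/2 * T i z‖ ≤ C/((i:ℝ)+2)) ∧ ‖A z‖ ≤ C ∧
    (∀ i, ‖f (i+2) z - A z * Complex.exp (z * (Lg i:ℂ))‖ ≤ C * Real.exp ((‖z‖-ε/2)*Lg i)) := by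
  obtain ⟨C, hC, h⟩ := T_prop ε hε hε1
  refine ⟨2*C, by positivity, fun z h0 h1 h2 => ?_⟩
  obtain ⟨ha, hb, hc⟩ := h z h0 h1 h2
  have hhalf : ∀ i j, i ≤ j → ‖(1/2) * T j z - (1/2) * T i z‖ ≤ C/((i:ℝ)+2) := by
    intro i j hij
    rw [← mul_sub, norm_mul]
    have := ha i j hij
    have e : ‖(1/2:ℂ)‖ = 1/2 := by norm_num
    rw [e]
    have := norm_nonneg (T j z - T i z)
    linarith
  have hcau : CauchySeq (fun i => (1/2) * T i z) := by
    refine cauchySeq_of_le_tendsto_0 (fun i : ℕ => 2*C/((i:ℝ)+2)) ?_ (tendsto_inv_shift _)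
    intro n m N hn hm
    have a1 := hhalf N n hn
    have a2 := hhalf N m hm
    calc dist ((1/2) * T n z) ((1/2) * T m z) ≤ dist ((1/2) * T n z) ((1/2) * T N z) + dist ((1/2) * T m z) ((1/2) * T N z) := dist_triangle_right _ _ _
      _ ≤ C/((N:ℝ)+2) + C/((N:ℝ)+2) := by
        rw [dist_eq_norm, dist_eq_norm]; linarith
      _ = _ := by ring
  have hlim : Tendsto (fun i => (1/2) * T i z) atTop (nhds (A z)) := hcau.tendsto_limUnder
  have hd : ∀ i, ‖A z - 1/2 * T i z‖ ≤ C/((i:ℝ)+2) := by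
    intro i
    have t : Tendsto (fun j => ‖(1/2) * T j z - (1/2) * T i z‖) atTop (nhds ‖A z - 1/2 * T i z‖) :=
      (hlim.sub_const _).norm
    refine le_of_tendsto t ?_
    filter_upwards [eventually_ge_atTop i] with j hj using hhalf i j hj
  refine ⟨fun i => (hd i).trans (by gcongr; linarith), ?_, ?_⟩
  · refine le_of_tendsto hlim.norm (Eventually.of_forall fun i => ?_)
    rw [norm_mul]
    have := hb i
    have e : ‖(1/2:ℂ)‖ = 1/2 := by norm_num
    rw [e]
    linarith
  · intro i
    have e : f (i+2) z - A z * Complex.exp (z * (Lg i:ℂ)) = (f (i+2) z - 1/2*(Complex.exp (z*(Lg i:ℂ)) * T i z))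
      - (A z - 1/2 * T i z) * Complex.exp (z * (Lg i:ℂ)) := by ring
    rw [e]
    refine (norm_sub_le _ _).trans ?_
    have n1 : ‖(A z - 1/2 * T i z) * Complex.exp (z * (Lg i:ℂ))‖ ≤ C * Real.exp ((‖z‖-ε/2)*Lg i) := by
      rw [norm_mul, Complex.norm_exp]
      have er : (z * (Lg i:ℂ)).re = z.re * Lg i := by simp
      rw [er]
      have hL := Lg_nonneg i
      have hre : z.re ≤ ‖z‖ := Complex.re_le_norm z
      calc _ ≤ C/((i:ℝ)+2) * Real.exp (z.re * Lg i) := by gcongr; exact hd i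
        _ = C * Real.exp (z.re * Lg i - Lg i) := by
          rw [sub_eq_add_neg, Real.exp_add, exp_neg_Lg]; ring
        _ ≤ _ := by
          gcongr
          nlinarith
    linarith [hc i]

lemma f_differentiableAt (n : ℕ) (z : ℂ) (hz : z ≠ 0) : DifferentiableAt ℂ (f n) z := by
  unfold f
  have h1 : DifferentiableAt ℂ (fun z : ℂ => (Q (n+1)).eval (z⁻¹^2)) z := by
    have h2 : DifferentiableAt ℂ (fun z : ℂ => z⁻¹^2) z := (differentiableAt_inv hz).pow 2
    exact ((Q (n+1)).differentiable _).comp z h2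
  exact ((differentiableAt_id.pow n).mul h1).div_const _

lemma T_differentiableAt (i : ℕ) (z : ℂ) (hz : z ≠ 0) : DifferentiableAt ℂ (T i) z := by
  unfold T Gs Us Vs
  have := f_differentiableAt (i+2) z hz
  have := f_differentiableAt (i+1) z hz
  fun_prop

def Dset (ε : ℝ) : Set ℂ := {z | 0 ≤ z.re ∧ ε ≤ ‖z‖ ∧ ‖z‖ ≤ 2}

lemma Dset_compact (ε : ℝ) : IsCompact (Dset ε) := by
  refine Metric.isCompact_of_isClosed_isBounded ?_ ?_
  · exact (isClosed_le continuous_const Complex.continuous_re).inter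
      ((isClosed_le continuous_const continuous_norm).inter (isClosed_le continuous_norm continuous_const))
  · refine Metric.isBounded_closedBall.subset (s := Dset ε) (t := Metric.closedBall 0 2) ?_
    intro z hz
    simpa using hz.2.2

lemma A_unif (ε : ℝ) (hε : 0 < ε) (hε1 : ε < 1) :
    TendstoUniformlyOn (fun i z => 1/2 * T i z) A atTop (Dset ε) := by
  obtain ⟨C, hC, h⟩ := A_prop ε hε hε1
  rw [Metric.tendstoUniformlyOn_iff]
  intro e he
  filter_upwards [(tendsto_inv_shift C).eventually_lt_const he] with i hi z hz
  rw [dist_eq_norm]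
  exact ((h z hz.1 hz.2.1 hz.2.2).1 i).trans_lt hi

lemma A_continuousOn (ε : ℝ) (hε : 0 < ε) (hε1 : ε < 1) : ContinuousOn A (Dset ε) := by
  refine (A_unif ε hε hε1).continuousOn (Frequently.of_forall fun i z hz => ?_)
  have hz0 : z ≠ 0 := by
    rintro rfl
    have := hz.2.1
    simp at this; linarith
  exact ((T_differentiableAt i z hz0).continuousAt.const_mul _).continuousWithinAt

lemma A_analyticAt (x : ℝ) (hx : x ∈ Set.Ioo (0:ℝ) 2) : AnalyticAt ℂ A (x:ℂ) := by
  let ε : ℝ := x/4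
  have hε : 0 < ε := by have := hx.1; simp only [ε]; linarith
  have hε1 : ε < 1 := by have := hx.2; simp only [ε]; linarith
  let U : Set ℂ := {z | 0 < z.re ∧ ε < ‖z‖ ∧ ‖z‖ < 2}
  have hU : IsOpen U := (isOpen_lt continuous_const Complex.continuous_re).inter
      ((isOpen_lt continuous_const continuous_norm).inter (isOpen_lt continuous_norm continuous_const))
  have hsub : U ⊆ Dset ε := fun z hz => ⟨hz.1.le, hz.2.1.le, hz.2.2.le⟩
  have hd : DifferentiableOn ℂ A U := by
    refine ((A_unif ε hε hε1).mono hsub).tendstoLocallyUniformlyOn.differentiableOn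
      (Eventually.of_forall fun i z hz => ?_) hU
    have hz0 : z ≠ 0 := by
      rintro rfl
      have := hz.1
      simp at this
    exact ((T_differentiableAt i z hz0).const_mul _).differentiableWithinAt
  refine hd.analyticAt (hU.mem_nhds ?_)
  have hn : ‖(x:ℂ)‖ = x := by rw [Complex.norm_real, Real.norm_of_nonneg hx.1.le]
  refine ⟨by simpa using hx.1, ?_, ?_⟩
  · rw [hn]; simp only [ε]; linarith [hx.1]
  · rw [hn]; exact hx.2

noncomputable def phi (x : ℝ) (n : ℕ) : ℝ := ∏ j ∈ range n, (1 + x/((j:ℝ)+3))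

lemma phi_pos (x : ℝ) (hx : 0 < x) (n : ℕ) : 0 < phi x n := prod_pos fun j _ => by positivity

lemma phi_step (x : ℝ) (hx : 0 < x) (i : ℕ) :
    phi x (i+2) ≤ phi x i + (2*x*(3*i+8)/(3*(i+2)*(i+3))) * phi x (i+1) := by
  have h1 : phi x (i+1) = phi x i * (1 + x/((i:ℝ)+3)) := prod_range_succ _ _
  have h2 : phi x (i+2) = phi x (i+1) * (1 + x/((i:ℝ)+4)) := by
    have := prod_range_succ (fun j : ℕ => (1 + x/((j:ℝ)+3))) (i+1)
    unfold phi
    rw [this]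
    push_cast
    rw [show (i:ℝ)+1+3 = i+4 by ring]
  have hp := phi_pos x hx i
  rw [h2, h1]
  have k0 : (0:ℝ) ≤ i := Nat.cast_nonneg i
  have k1 : 2*(x/((i:ℝ)+3)) ≤ (2*x*(3*i+8)/(3*(i+2)*(i+3))) := by
    rw [← mul_div_assoc, div_le_div_iff₀ (by positivity) (by positivity)]
    nlinarith [mul_nonneg hx.le k0, mul_nonneg (mul_nonneg hx.le k0) k0]
  have k2 : x/((i:ℝ)+4) ≤ x/((i:ℝ)+3) := by gcongr; norm_num
  have k3 : 0 ≤ x/((i:ℝ)+4) := by positivity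
  set u := x/((i:ℝ)+3)
  set v := x/((i:ℝ)+4)
  set c := (2*x*(3*i+8)/(3*((i:ℝ)+2)*(i+3)))
  have : (1+u)*(1+v) ≤ 1 + c*(1+u) := by nlinarith
  nlinarith

lemma phi_ge (x : ℝ) (hx : 0 < x) (hx2 : x < 2) (n : ℕ) :
    Real.exp (x * (Real.log ((n:ℝ)+5) - Real.log 5)) ≤ phi x n := by
  induction n with
  | zero => simp [phi]
  | succ n ih =>
    have h1 : phi x (n+1) = phi x n * (1 + x/((n:ℝ)+3)) := prod_range_succ _ _
    rw [h1]
    have e : x * (Real.log (((n+1:ℕ):ℝ)+5) - Real.log 5) = x * (Real.log ((n:ℝ)+5) - Real.log 5)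
      + x * (Real.log ((n:ℝ)+6) - Real.log ((n:ℝ)+5)) := by
      push_cast
      rw [show (n:ℝ)+1+5 = n+6 by ring]; ring
    rw [e, Real.exp_add]
    have k0 : (0:ℝ) ≤ n := Nat.cast_nonneg n
    have hs : Real.exp (x * (Real.log ((n:ℝ)+6) - Real.log ((n:ℝ)+5))) ≤ 1 + x/((n:ℝ)+3) := by
      rw [← Real.le_log_iff_exp_le (by positivity), ← Real.log_div (by positivity) (by positivity)]
      have a1 : Real.log (((n:ℝ)+6)/((n:ℝ)+5)) ≤ 1/((n:ℝ)+5) := by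
        have := Real.log_le_sub_one_of_pos (x := ((n:ℝ)+6)/((n:ℝ)+5)) (by positivity)
        refine this.trans (le_of_eq ?_)
        field_simp; ring
      have a2 := Real.one_sub_inv_le_log_of_pos (x := 1 + x/((n:ℝ)+3)) (by positivity)
      refine le_trans ?_ a2
      have a3 : 1 - (1 + x/((n:ℝ)+3))⁻¹ = x/((n:ℝ)+3+x) := by
        field_simp; ring
      rw [a3]
      calc _ ≤ x * (1/((n:ℝ)+5)) := by gcongr
        _ = x/((n:ℝ)+5) := by ring
        _ ≤ _ := div_le_div_of_nonneg_left hx.le (by positivity) (by linarith)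
    exact mul_le_mul ih hs (Real.exp_pos _).le (phi_pos x hx n).le

lemma f_real (x : ℝ) (hx : 0 < x) (hx2 : x < 2) (n : ℕ) :
    ∃ r : ℝ, f n (x:ℂ) = (r:ℂ) ∧ phi x n ≤ r := by
  induction n using Nat.strong_induction_on with
  | _ n ih =>
  have hx0 : (x:ℂ) ≠ 0 := by exact_mod_cast hx.ne'
  match n, ih with
  | 0, _ => exact ⟨2, by rw [f_zero]; norm_num, by simp [phi]⟩
  | 1, _ =>
    refine ⟨(20*x+5*x⁻¹)/6, by rw [f_one _ hx0]; push_cast; ring, ?_⟩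
    simp only [phi, prod_range_one]
    have : x * x⁻¹ = 1 := mul_inv_cancel₀ hx.ne'
    have h2 : 0 < x⁻¹ := by positivity
    push_cast
    have : 20 * x + 5 * x⁻¹ ≥ 20 := by nlinarith [sq_nonneg (2*x-1)]
    linarith
  | i+2, ih =>
    have key : ∀ k : ℕ, ∃ r : ℝ, k < i+2 → f k (x:ℂ) = (r:ℂ) ∧ phi x k ≤ r := by
      intro k
      by_cases hk : k < i+2
      · obtain ⟨r, hr⟩ := ih k hk
        exact ⟨r, fun _ => hr⟩
      · exact ⟨0, fun h => absurd h hk⟩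
    choose r hr using key
    have h0 : ∀ k, k < i+2 → 0 ≤ r k := fun k hk => (phi_pos x hx k).le.trans (hr k hk).2
    refine ⟨((9*((i:ℝ)+2)^2-4)/(9*((i:ℝ)+1)*((i:ℝ)+3))) * r i + (2*x*(3*i+8)/(3*(i+2)*(i+3))) * r (i+1)
      + x^2*(3*i+8)/(9*(i+3)) * ((1/((i+1)*(i+2))) * ∑ k ∈ range (i+1), (1/(i.choose k:ℝ)) * (r k * r (i-k))), ?_, ?_⟩
    · have := f_rec (x:ℂ) hx0 i
      simp only at this
      rw [this, (hr i (by omega)).1, (hr (i+1) (by omega)).1]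
      push_cast
      congr 3
      refine sum_congr rfl fun k hk => ?_
      rw [mem_range] at hk
      rw [(hr k (by omega)).1, (hr (i-k) (by omega)).1]
    · refine (phi_step x hx i).trans ?_
      have k0 : (0:ℝ) ≤ i := Nat.cast_nonneg i
      have c1 : 1 ≤ (9*((i:ℝ)+2)^2-4)/(9*((i:ℝ)+1)*((i:ℝ)+3)) := by
        rw [le_div_iff₀ (by positivity)]; nlinarith
      have s0 : 0 ≤ x^2*(3*i+8)/(9*((i:ℝ)+3)) * ((1/(((i:ℝ)+1)*(i+2))) * ∑ k ∈ range (i+1), (1/(i.choose k:ℝ)) * (r k * r (i-k))) := by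
        have : 0 ≤ ∑ k ∈ range (i+1), (1/(i.choose k:ℝ)) * (r k * r (i-k)) := by
          refine sum_nonneg fun k hk => ?_
          rw [mem_range] at hk
          have := h0 k (by omega)
          have := h0 (i-k) (by omega)
          positivity
        positivity
      have p1 : phi x i ≤ (9*((i:ℝ)+2)^2-4)/(9*((i:ℝ)+1)*((i:ℝ)+3)) * r i := by
        have := (hr i (by omega)).2
        have := h0 i (by omega)
        nlinarith
      have p2 : (2*x*(3*i+8)/(3*((i:ℝ)+2)*(i+3))) * phi x (i+1) ≤ (2*x*(3*i+8)/(3*((i:ℝ)+2)*(i+3))) * r (i+1) := by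
        have := (hr (i+1) (by omega)).2
        gcongr
      linarith

lemma A_real (x : ℝ) (hx : x ∈ Set.Ioo (0:ℝ) 2) : (A (x:ℂ)).im = 0 ∧ 1/25 ≤ (A (x:ℂ)).re := by
  obtain ⟨hx0, hx2⟩ := hx
  have hε : 0 < x/4 := by linarith
  have hε1 : x/4 < 1 := by linarith
  obtain ⟨C, hC, h⟩ := A_prop (x/4) hε hε1
  have hn : ‖(x:ℂ)‖ = x := by rw [Complex.norm_real, Real.norm_of_nonneg hx0.le]
  obtain ⟨-, -, hA⟩ := h (x:ℂ) (by simpa using hx0.le) (by rw [hn]; linarith) (by rw [hn]; exact hx2.le)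
  choose r hr using fun n => f_real x hx0 hx2 n
  have hb : ∀ i, ‖(((r (i+2)) * Real.exp (-(x*Lg i)) : ℝ):ℂ) - A (x:ℂ)‖ ≤ C * Real.exp (-(x/8) * Lg i) := by
    intro i
    have h1 := hA i
    rw [(hr (i+2)).1, hn] at h1
    have e1 : Complex.exp ((x:ℂ) * (Lg i:ℂ)) = ((Real.exp (x*Lg i) : ℝ):ℂ) := by push_cast; rfl
    rw [e1] at h1
    have hne : ((Real.exp (x*Lg i) : ℝ):ℂ) ≠ 0 := by exact_mod_cast (Real.exp_pos _).ne'
    have e2 : (((r (i+2)) * Real.exp (-(x*Lg i)) : ℝ):ℂ) - A (x:ℂ) = ((Real.exp (-(x*Lg i)) : ℝ):ℂ) * ((r (i+2) : ℂ) - A (x:ℂ) * ((Real.exp (x*Lg i) : ℝ):ℂ)) := by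
      rw [Real.exp_neg]
      push_cast at hne ⊢
      field_simp
    rw [e2, norm_mul, Complex.norm_real, Real.norm_of_nonneg (Real.exp_pos _).le]
    calc _ ≤ Real.exp (-(x*Lg i)) * (C * Real.exp ((x - x/4/2)*Lg i)) := by gcongr
      _ = C * (Real.exp (-(x*Lg i)) * Real.exp ((x - x/4/2)*Lg i)) := by ring
      _ = _ := by rw [← Real.exp_add]; ring_nf
  have ht0 : Tendsto (fun i => C * Real.exp (-(x/8) * Lg i)) atTop (nhds 0) := by
    have : Tendsto (fun i => -(x/8) * Lg i) atTop atBot := tendsto_Lg.const_mul_atTop_of_neg (by linarith)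
    simpa using (Real.tendsto_exp_atBot.comp this).const_mul C
  have ht : Tendsto (fun i => (((r (i+2)) * Real.exp (-(x*Lg i)) : ℝ):ℂ)) atTop (nhds (A (x:ℂ))) := by
    rw [tendsto_iff_norm_sub_tendsto_zero]
    exact squeeze_zero (fun _ => norm_nonneg _) hb ht0
  constructor
  · have := (Complex.continuous_im.tendsto _).comp ht
    have h2 : (Complex.im ∘ fun i => (((r (i+2)) * Real.exp (-(x*Lg i)) : ℝ):ℂ)) = fun _ => 0 := by
      funext i; simp only [Function.comp, Complex.ofReal_im]
    rw [h2] at this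
    exact (tendsto_nhds_unique this tendsto_const_nhds)
  · have := (Complex.continuous_re.tendsto _).comp ht
    refine ge_of_tendsto this (Eventually.of_forall fun i => ?_)
    simp only [Function.comp, Complex.ofReal_re]
    have p := (phi_ge x hx0 hx2 (i+2)).trans (hr (i+2)).2
    have k0 : (0:ℝ) ≤ i := Nat.cast_nonneg i
    have l1 : Lg i ≤ Real.log (((i+2:ℕ):ℝ)+5) := by
      unfold Lg
      apply Real.log_le_log (by positivity)
      push_cast; linarith
    have l2 : 0 < Real.log 5 := Real.log_pos (by norm_num)
    calc (1/25:ℝ) = Real.exp (-(2*Real.log 5)) := by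
          rw [Real.exp_neg, two_mul, Real.exp_add, Real.exp_log (by norm_num)]; norm_num
      _ ≤ Real.exp (x * (Real.log (((i+2:ℕ):ℝ)+5) - Real.log 5) + -(x * Lg i)) := by
          apply Real.exp_le_exp.2
          nlinarith
      _ ≤ _ := by
          rw [Real.exp_add]
          gcongr

end CubicMaps

namespace CubicMaps

lemma int_exp (k : ℤ) : ∫ θ in (-(Real.pi/2))..(Real.pi/2), Complex.exp (2*k*Complex.I*(θ:ℂ)) = if k = 0 then (Real.pi:ℂ) else 0 := by
  split_ifs with h
  · subst h; simp
  · have hc : (2*(k:ℂ)*Complex.I) ≠ 0 := by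
      simp [h]
    rw [integral_exp_mul_complex hc]
    have e : 2*(k:ℂ)*Complex.I*((Real.pi/2:ℝ):ℂ) = 2*(k:ℂ)*Complex.I*((-(Real.pi/2):ℝ):ℂ) + k * (2*Real.pi*Complex.I) := by
      push_cast; ring
    rw [e, Complex.exp_add, Complex.exp_int_mul_two_pi_mul_I]
    simp

noncomputable def zc (r θ : ℝ) : ℂ := r * Complex.exp (θ * Complex.I)

lemma zc_ne (r θ : ℝ) (hr : 0 < r) : zc r θ ≠ 0 := by
  unfold zc
  have : (r:ℂ) ≠ 0 := by exact_mod_cast hr.ne'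
  exact mul_ne_zero this (Complex.exp_ne_zero _)

lemma zc_norm (r θ : ℝ) (hr : 0 < r) : ‖zc r θ‖ = r := by
  unfold zc
  rw [norm_mul, Complex.norm_exp_ofReal_mul_I, Complex.norm_real, Real.norm_of_nonneg hr.le, mul_one]

lemma zc_re (r θ : ℝ) : (zc r θ).re = r * Real.cos θ := by
  unfold zc
  rw [Complex.re_ofReal_mul, Complex.exp_ofReal_mul_I_re]

lemma zc_cont (r : ℝ) : Continuous (zc r) := by unfold zc; fun_prop

lemma zc_sub (r θ : ℝ) (hr : 0 < r) : ‖zc r θ - r‖ ≤ r * |θ| := by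
  have e : zc r θ - r = r * (Complex.exp (Complex.I * θ) - 1) := by unfold zc; rw [mul_comm Complex.I]; ring
  rw [e, norm_mul, Complex.norm_real, Real.norm_of_nonneg hr.le]
  gcongr
  exact Real.norm_exp_I_mul_ofReal_sub_one_le

lemma coeff_int (r : ℝ) (hr : 0 < r) (g : ℕ) (P : Polynomial ℂ) :
    ∫ θ in (-(Real.pi/2))..(Real.pi/2), (zc r θ)^(2*g) * P.eval ((zc r θ)⁻¹^2) = Real.pi * P.coeff g := by
  have hcont : ∀ P : Polynomial ℂ, Continuous fun θ => (zc r θ)^(2*g) * P.eval ((zc r θ)⁻¹^2) := by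
    intro P
    have h1 : Continuous fun θ => (zc r θ)⁻¹ := (zc_cont r).inv₀ fun θ => zc_ne r θ hr
    exact ((zc_cont r).pow _).mul (P.continuous.comp (h1.pow 2))
  induction P using Polynomial.induction_on' with
  | add p q hp hq =>
    simp only [Polynomial.eval_add, mul_add, Polynomial.coeff_add]
    rw [intervalIntegral.integral_add ((hcont p).intervalIntegrable _ _) ((hcont q).intervalIntegrable _ _), hp, hq]
  | monomial k a =>
    have hr0 : (r:ℂ) ≠ 0 := by exact_mod_cast hr.ne'
    have e : ∀ θ : ℝ, (zc r θ)^(2*g) * (Polynomial.monomial k a).eval ((zc r θ)⁻¹^2)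
        = (a * (r:ℂ)^(2*((g:ℤ)-k))) * Complex.exp (2*((g:ℤ)-(k:ℤ):ℤ)*Complex.I*(θ:ℂ)) := by
      intro θ
      have h0 := zc_ne r θ hr
      rw [Polynomial.eval_monomial]
      have e1 : (zc r θ)^(2*g) * (a * ((zc r θ)⁻¹^2)^k) = a * (zc r θ)^(2*((g:ℤ)-k)) := by
        rw [mul_sub, zpow_sub₀ h0, ← pow_mul, inv_pow]
        have t1 : (zc r θ)^(2*(g:ℤ)) = (zc r θ)^(2*g) := by exact_mod_cast zpow_natCast (zc r θ) (2*g)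
        have t2 : (zc r θ)^(2*(k:ℤ)) = (zc r θ)^(2*k) := by exact_mod_cast zpow_natCast (zc r θ) (2*k)
        rw [t1, t2]
        field_simp
      rw [e1, zc, mul_zpow, ← Complex.exp_int_mul, mul_assoc]
      congr 3
      push_cast; ring
    simp_rw [e]
    rw [intervalIntegral.integral_const_mul, int_exp, Polynomial.coeff_monomial]
    by_cases hk : k = g
    · subst hk; simp; ring
    · have : ¬ ((g:ℤ)-k = 0) := by omega
      simp [hk, this]

lemma exp_int (r : ℝ) (hr : 0 < r) (L : ℝ) (m : ℕ) :
    ∫ θ in (-(Real.pi/2))..(3*Real.pi/2), Complex.exp (L * zc r θ) * ((zc r θ)^m)⁻¹ = 2*Real.pi*(L:ℂ)^m/(m.factorial:ℂ) := by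
  have hper : Function.Periodic (fun θ => Complex.exp (L * zc r θ) * ((zc r θ)^m)⁻¹) (2*Real.pi) := by
    intro θ
    have : zc r (θ + 2*Real.pi) = zc r θ := by
      unfold zc
      have : ((θ + 2*Real.pi : ℝ):ℂ) * Complex.I = θ * Complex.I + 2*Real.pi*Complex.I := by push_cast; ring
      rw [this, Complex.exp_periodic]
    simp only [this]
  have h1 := hper.intervalIntegral_add_eq (-(Real.pi/2)) 0
  rw [show -(Real.pi/2) + 2*Real.pi = 3*Real.pi/2 by ring, zero_add] at h1
  rw [h1]
  have hd : DifferentiableOn ℂ (fun z : ℂ => Complex.exp (L * z)) (Metric.closedBall 0 r) := by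
    fun_prop
  have h2 := hd.circleIntegral_one_div_sub_center_pow_smul hr m
  have hder : iteratedDeriv m (fun z : ℂ => Complex.exp (L * z)) 0 = (L:ℂ)^m := by
    rw [iteratedDeriv_cexp_const_mul]; simp
  rw [hder] at h2
  have h3 : (∮ (z : ℂ) in C(0, r), (1 / (z - 0) ^ (m + 1)) • Complex.exp (↑L * z)) = Complex.I * ∫ θ in (0:ℝ)..(2*Real.pi), Complex.exp (L * zc r θ) * ((zc r θ)^m)⁻¹ := by
    rw [circleIntegral, ← intervalIntegral.integral_const_mul]
    refine intervalIntegral.integral_congr fun θ _ => ?_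
    have h0 := zc_ne r θ hr
    have e : circleMap 0 r θ = zc r θ := by simp [circleMap, zc]
    simp only [deriv_circleMap, smul_eq_mul, e, sub_zero]
    field_simp
    ring
  rw [h3] at h2
  have hI := Complex.I_ne_zero
  have : Complex.I * ∫ θ in (0:ℝ)..(2*Real.pi), Complex.exp (L * zc r θ) * ((zc r θ)^m)⁻¹ = Complex.I * (2*Real.pi*(L:ℂ)^m/(m.factorial:ℂ)) := by
    rw [h2, smul_eq_mul]; ring
  exact mul_left_cancel₀ hI this

lemma fact_bound (m : ℕ) (hm : 1 ≤ m) : (m.factorial:ℝ) / (m:ℝ)^m ≤ Real.exp 1 * (Real.sqrt m * Real.exp (-(m:ℝ))) := by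
  obtain ⟨k, rfl⟩ : ∃ k, m = k+1 := ⟨m-1, by omega⟩
  have h := Stirling.stirlingSeq'_antitone (Nat.zero_le k)
  simp only [Function.comp, Nat.succ_eq_add_one, zero_add, Stirling.stirlingSeq_one] at h
  unfold Stirling.stirlingSeq at h
  set m := k+1
  have hm0 : (0:ℝ) < m := by exact_mod_cast hm
  have hs : Real.sqrt (2*(m:ℝ)) = Real.sqrt 2 * Real.sqrt m := Real.sqrt_mul (by norm_num) _
  have hs2 : 0 < Real.sqrt 2 := by positivity
  have hsm : 0 < Real.sqrt m := by positivity
  have he : (Real.exp 1)^m = Real.exp m := by rw [← Real.exp_nat_mul]; ring_nf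
  rw [hs, div_pow, he, div_le_div_iff₀ (by positivity) hs2] at h
  rw [Real.exp_neg, div_le_iff₀ (by positivity)]
  have e2 : (Real.exp 1 * (Real.sqrt 2 * Real.sqrt m * ((m:ℝ)^m/Real.exp m))) = (Real.exp 1 * (Real.sqrt m * (Real.exp m)⁻¹) * (m:ℝ)^m) * Real.sqrt 2 := by
    field_simp
  rw [e2] at h
  exact le_of_mul_le_mul_right h hs2

/-- Gaussian-type bound for the central part. -/
lemma gauss_bound (m : ℕ) (hm : 1 ≤ m) (η B : ℝ) (hη : 0 ≤ η) (hB : 0 ≤ B) :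
    ∫ θ in (-(Real.pi/2))..(Real.pi/2), (η + B*θ^2) * Real.exp (m*Real.cos θ)
      ≤ Real.exp m * ((η + B*Real.pi^2/m) * (Real.sqrt (Real.pi^3) / Real.sqrt m)) := by
  have hm0 : (0:ℝ) < m := by exact_mod_cast hm
  have hpi := Real.pi_pos
  have hb : 0 < (m:ℝ)/Real.pi^2 := by positivity
  have hgint := integrable_exp_neg_mul_sq hb
  have hle : -(Real.pi/2) ≤ Real.pi/2 := by linarith
  have step1 : ∀ θ ∈ Set.Icc (-(Real.pi/2)) (Real.pi/2), (η + B*θ^2) * Real.exp (m*Real.cos θ)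
      ≤ Real.exp m * (η + B*Real.pi^2/m) * Real.exp (-((m:ℝ)/Real.pi^2) * θ^2) := by
    intro θ hθ
    have hc := Real.cos_le_one_sub_mul_cos_sq (x := θ) (abs_le.2 ⟨by linarith [hθ.1], by linarith [hθ.2]⟩)
    set u := (m:ℝ)/Real.pi^2 * θ^2 with hu
    have hu0 : 0 ≤ u := by positivity
    have e1 : Real.exp (m*Real.cos θ) ≤ Real.exp m * Real.exp (-u) * Real.exp (-u) := by
      rw [← Real.exp_add, ← Real.exp_add]
      apply Real.exp_le_exp.2
      have : (m:ℝ)*Real.cos θ ≤ m * (1 - 2/Real.pi^2*θ^2) := by gcongr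
      refine this.trans (le_of_eq ?_)
      rw [hu]; ring
    have e2 : θ^2 = Real.pi^2/m * u := by rw [hu]; field_simp
    have e3 : (η + B*θ^2) * Real.exp (-u) ≤ η + B*Real.pi^2/m := by
      have k1 : Real.exp (-u) ≤ 1 := Real.exp_le_one_iff.2 (by linarith)
      have k2 : u * Real.exp (-u) ≤ 1 := by
        rw [Real.exp_neg, ← div_eq_mul_inv, div_le_one (Real.exp_pos _)]
        linarith [Real.add_one_le_exp u]
      have : (η + B*θ^2) * Real.exp (-u) = η * Real.exp (-u) + B*Real.pi^2/m * (u * Real.exp (-u)) := by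
        rw [e2]; ring
      rw [this]
      have a1 : η * Real.exp (-u) ≤ η * 1 := by gcongr
      have a2 : B*Real.pi^2/m * (u * Real.exp (-u)) ≤ B*Real.pi^2/m * 1 := by gcongr
      linarith
    have e4 : -((m:ℝ)/Real.pi^2) * θ^2 = -u := by rw [hu]; ring
    rw [e4]
    calc (η + B*θ^2) * Real.exp (m*Real.cos θ) ≤ (η + B*θ^2) * (Real.exp m * Real.exp (-u) * Real.exp (-u)) := by gcongr
      _ = Real.exp m * ((η + B*θ^2) * Real.exp (-u)) * Real.exp (-u) := by ring
      _ ≤ _ := by gcongr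
  have step2 : ∫ θ in (-(Real.pi/2))..(Real.pi/2), (η + B*θ^2) * Real.exp (m*Real.cos θ)
      ≤ ∫ θ in (-(Real.pi/2))..(Real.pi/2), Real.exp m * (η + B*Real.pi^2/m) * Real.exp (-((m:ℝ)/Real.pi^2) * θ^2) := by
    apply intervalIntegral.integral_mono_on hle _ _ step1
    · exact Continuous.intervalIntegrable (by fun_prop) _ _
    · exact Continuous.intervalIntegrable (by fun_prop) _ _
  refine step2.trans ?_
  rw [intervalIntegral.integral_const_mul, mul_assoc]
  gcongr
  rw [intervalIntegral.integral_of_le hle]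
  calc _ ≤ ∫ θ, Real.exp (-((m:ℝ)/Real.pi^2) * θ^2) :=
        MeasureTheory.setIntegral_le_integral hgint (Eventually.of_forall fun θ => (Real.exp_pos _).le)
    _ = _ := by
      rw [integral_gaussian, ← Real.sqrt_div (by positivity)]
      congr 1
      field_simp

end CubicMaps

namespace CubicMaps

lemma zc_mem (ε r θ : ℝ) (hε : 0 < ε) (h1 : ε ≤ r) (h2 : r ≤ 2) (hθ : θ ∈ Set.Icc (-(Real.pi/2)) (Real.pi/2)) :
    zc r θ ∈ Dset ε := by
  have hr : 0 < r := by linarith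
  refine ⟨?_, ?_, ?_⟩
  · rw [zc_re]
    exact mul_nonneg hr.le (Real.cos_nonneg_of_mem_Icc hθ)
  · rw [zc_norm _ _ hr]; exact h1
  · rw [zc_norm _ _ hr]; exact h2

lemma zc_zero (r : ℝ) : zc r 0 = r := by simp [zc]

lemma A_modulus (ε : ℝ) (hε : 0 < ε) (hε1 : ε < 1) (η : ℝ) (hη : 0 < η) : ∃ B : ℝ, 0 ≤ B ∧
    ∀ r θ : ℝ, ε ≤ r → r ≤ 2 → θ ∈ Set.Icc (-(Real.pi/2)) (Real.pi/2) → ‖A (zc r θ) - A r‖ ≤ η + B * θ^2 := by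
  obtain ⟨C, hC, h⟩ := A_prop ε hε hε1
  have huc := (Dset_compact ε).uniformContinuousOn_of_continuous (A_continuousOn ε hε hε1)
  rw [Metric.uniformContinuousOn_iff] at huc
  obtain ⟨d, hd, hu⟩ := huc η hη
  refine ⟨8*C/d^2, by positivity, fun r θ h1 h2 hθ => ?_⟩
  have hr : 0 < r := by linarith
  have hpi := Real.pi_pos
  have m1 := zc_mem ε r θ hε h1 h2 hθ
  have m0 : (r:ℂ) ∈ Dset ε := by
    have := zc_mem ε r 0 hε h1 h2 ⟨by linarith, by linarith⟩
    rwa [zc_zero] at this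
  have hs := zc_sub r θ hr
  by_cases hc : 2*|θ| < d
  · have : dist (zc r θ) (r:ℂ) < d := by
      rw [dist_eq_norm]
      have := abs_nonneg θ
      nlinarith
    have := hu _ m1 _ m0 this
    rw [dist_eq_norm] at this
    have : 0 ≤ 8*C/d^2*θ^2 := by positivity
    linarith
  · push Not at hc
    have b1 := (h _ m1.1 m1.2.1 m1.2.2).2.1
    have b0 := (h _ m0.1 m0.2.1 m0.2.2).2.1
    have b := norm_sub_le (A (zc r θ)) (A r)
    have : 2*C ≤ 8*C/d^2*θ^2 := by
      rw [div_mul_eq_mul_div, le_div_iff₀ (by positivity)]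
      have : d^2 ≤ 4*θ^2 := by
        rw [← sq_abs θ]; nlinarith
      nlinarith
    linarith

lemma tendsto_sqrt_exp (c : ℝ) (hc : 0 < c) : Tendsto (fun m : ℕ => Real.sqrt m * Real.exp (-(c*m))) atTop (nhds 0) := by
  have h1 : Tendsto (fun m : ℕ => c * (m:ℝ)) atTop atTop := tendsto_natCast_atTop_atTop.const_mul_atTop hc
  have h2 := ((Real.tendsto_pow_mul_exp_neg_atTop_nhds_zero 1).comp h1).const_mul (1/c)
  rw [mul_zero] at h2
  refine squeeze_zero (fun m => by positivity) (fun m => ?_) h2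
  simp only [Function.comp, pow_one]
  rw [← mul_assoc, ← mul_assoc, one_div, inv_mul_cancel₀ hc.ne', one_mul]
  gcongr
  rcases Nat.eq_zero_or_pos m with rfl | hm
  · simp
  · have : (1:ℝ) ≤ m := by exact_mod_cast hm
    rw [Real.sqrt_le_left (by linarith)]
    nlinarith

lemma main_bound (ε : ℝ) (hε : 0 < ε) (hε1 : ε < 1) : ∃ C : ℝ, 0 ≤ C ∧ ∀ η : ℝ, 0 < η → ∃ B : ℝ, 0 ≤ B ∧
    ∀ n m g : ℕ, 2 ≤ n → n = m + 2*g → 1 ≤ m → ε ≤ (m:ℝ)/Real.log n → (m:ℝ)/Real.log n ≤ 2 →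
    ‖(Q (n+1)).coeff g / (6^n * (n.factorial:ℂ)) * ((m.factorial:ℂ)/(Real.log n:ℂ)^m) - 2 * A (((m:ℝ)/Real.log n : ℝ):ℂ)‖
      ≤ C * (Real.sqrt m * Real.exp (-(ε/4*m))) + C * (η + B/m) + C * (Real.sqrt m * Real.exp (-(1*(m:ℝ)))) := by
  obtain ⟨C, hC, h⟩ := A_prop ε hε hε1
  have hpi := Real.pi_pos
  have hpi1 : 1 ≤ Real.pi := by linarith [Real.pi_gt_three]
  refine ⟨Real.exp 1 * (Real.pi * C + Real.sqrt (Real.pi^3)), by positivity, fun η hη => ?_⟩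
  obtain ⟨B, hB, hmod⟩ := A_modulus ε hε hε1 η hη
  refine ⟨B * Real.pi^2, by positivity, fun n m g hn hnm hm hr1 hr2 => ?_⟩
  set L := Real.log n with hLdef
  have hm0 : (0:ℝ) < m := by exact_mod_cast hm
  have hL : 0 < L := Real.log_pos (by exact_mod_cast hn)
  set r := (m:ℝ)/L with hrdef
  have hr : 0 < r := by positivity
  have hLr : L * r = m := by rw [hrdef]; field_simp
  have hLg : Lg (n-2) = L := by
    unfold Lg
    rw [hLdef]; congr 1
    rw [Nat.cast_sub hn]; push_cast; ring
  have hzL : ∀ θ, zc r θ ≠ 0 := fun θ => zc_ne r θ hr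
  have hle : -(Real.pi/2) ≤ Real.pi/2 := by linarith
  have hle2 : Real.pi/2 ≤ 3*Real.pi/2 := by linarith
  -- the three integrands
  set E : ℝ → ℂ := fun θ => Complex.exp (L * zc r θ) * ((zc r θ)^m)⁻¹ with hE
  have hEc : Continuous E := by
    have := zc_cont r
    exact (Complex.continuous_exp.comp (continuous_const.mul this)).mul ((this.pow m).inv₀ fun θ => pow_ne_zero _ (hzL θ))
  have hEn : ∀ θ, ‖E θ‖ = (r^m)⁻¹ * Real.exp (m * Real.cos θ) := by
    intro θ
    simp only [hE]
    rw [norm_mul, norm_inv, norm_pow, zc_norm _ _ hr, Complex.norm_exp, Complex.re_ofReal_mul, zc_re, ← mul_assoc, hLr]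
    ring
  have hAc : ContinuousOn (fun θ => A (zc r θ)) (Set.uIcc (-(Real.pi/2)) (Real.pi/2)) := by
    rw [Set.uIcc_of_le hle]
    exact (A_continuousOn ε hε hε1).comp (zc_cont r).continuousOn fun θ hθ => zc_mem ε r θ hε hr1 hr2 hθ
  set G : ℝ → ℂ := fun θ => f n (zc r θ) * ((zc r θ)^m)⁻¹ with hG
  have hGc : Continuous G := by
    rw [continuous_iff_continuousAt]
    intro θ
    exact ContinuousAt.mul (ContinuousAt.comp (f_differentiableAt n _ (hzL θ)).continuousAt (zc_cont r).continuousAt)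
      (((zc_cont r).continuousAt.pow m).inv₀ (pow_ne_zero _ (hzL θ)))
  set hh : ℂ := (Q (n+1)).coeff g / (6^n * (n.factorial:ℂ)) with hhh
  have hGint : ∫ θ in (-(Real.pi/2))..(Real.pi/2), G θ = Real.pi * hh := by
    have e : ∀ θ, G θ = ((zc r θ)^(2*g) * (Q (n+1)).eval ((zc r θ)⁻¹^2)) * (6^n * (n.factorial:ℂ))⁻¹ := by
      intro θ
      simp only [hG, f]
      rw [show (zc r θ)^n = (zc r θ)^m * (zc r θ)^(2*g) by rw [← pow_add, hnm]]
      have := pow_ne_zero m (hzL θ)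
      field_simp
    simp_rw [e]
    rw [intervalIntegral.integral_mul_const, coeff_int r hr g, hhh]
    ring
  have hEint : (∫ θ in (-(Real.pi/2))..(Real.pi/2), E θ) + ∫ θ in (Real.pi/2)..(3*Real.pi/2), E θ = 2*Real.pi*(L:ℂ)^m/(m.factorial:ℂ) := by
    rw [intervalIntegral.integral_add_adjacent_intervals (hEc.intervalIntegrable _ _) (hEc.intervalIntegrable _ _)]
    exact exp_int r hr L m
  set I1 := ∫ θ in (-(Real.pi/2))..(Real.pi/2), (G θ - A (zc r θ) * E θ)
  set I2 := ∫ θ in (-(Real.pi/2))..(Real.pi/2), (A (zc r θ) - A r) * E θ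
  set I3 := ∫ θ in (Real.pi/2)..(3*Real.pi/2), E θ
  have hAE : IntervalIntegrable (fun θ => A (zc r θ) * E θ) MeasureTheory.volume (-(Real.pi/2)) (Real.pi/2) :=
    (hAc.mul hEc.continuousOn).intervalIntegrable
  have hX : Real.pi * hh - A r * (2*Real.pi*(L:ℂ)^m/(m.factorial:ℂ)) = I1 + I2 - A r * I3 := by
    have a1 : I1 = Real.pi * hh - ∫ θ in (-(Real.pi/2))..(Real.pi/2), A (zc r θ) * E θ := by
      rw [← hGint]
      exact intervalIntegral.integral_sub (hGc.intervalIntegrable _ _) hAE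
    have a2 : I2 = (∫ θ in (-(Real.pi/2))..(Real.pi/2), A (zc r θ) * E θ) - A r * ∫ θ in (-(Real.pi/2))..(Real.pi/2), E θ := by
      rw [← intervalIntegral.integral_const_mul, ← intervalIntegral.integral_sub hAE ((hEc.const_mul _).intervalIntegrable _ _)]
      refine intervalIntegral.integral_congr fun θ _ => ?_
      ring
    rw [a1, a2, ← hEint]; ring
  have hrm : 0 < (r^m)⁻¹ := by positivity
  have hb1 : ‖I1‖ ≤ (r^m)⁻¹ * (C * Real.exp ((r - ε/2)*L)) * Real.pi := by
    have : ∀ θ ∈ Set.uIoc (-(Real.pi/2)) (Real.pi/2), ‖G θ - A (zc r θ) * E θ‖ ≤ (r^m)⁻¹ * (C * Real.exp ((r - ε/2)*L)) := by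
      intro θ hθ
      rw [Set.uIoc_of_le hle] at hθ
      have hz := zc_mem ε r θ hε hr1 hr2 (Set.Ioc_subset_Icc_self hθ)
      have hk := (h _ hz.1 hz.2.1 hz.2.2).2.2 (n-2)
      rw [hLg, zc_norm _ _ hr, show n-2+2 = n by omega] at hk
      have e : G θ - A (zc r θ) * E θ = (f n (zc r θ) - A (zc r θ) * Complex.exp (zc r θ * (L:ℂ))) * ((zc r θ)^m)⁻¹ := by
        simp only [hG, hE]; rw [mul_comm (L:ℂ)]; ring
      rw [e, norm_mul, norm_inv, norm_pow, zc_norm _ _ hr, mul_comm]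
      gcongr
    refine (intervalIntegral.norm_integral_le_of_norm_le_const this).trans (le_of_eq ?_)
    rw [show Real.pi/2 - -(Real.pi/2) = Real.pi by ring, abs_of_pos hpi]
  have hb2 : ‖I2‖ ≤ (r^m)⁻¹ * (Real.exp m * ((η + B*Real.pi^2/m) * (Real.sqrt (Real.pi^3) / Real.sqrt m))) := by
    have : ‖I2‖ ≤ ∫ θ in (-(Real.pi/2))..(Real.pi/2), (r^m)⁻¹ * ((η + B*θ^2) * Real.exp (m*Real.cos θ)) := by
      refine intervalIntegral.norm_integral_le_of_norm_le hle (Eventually.of_forall fun θ hθ => ?_)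
        (Continuous.intervalIntegrable (by fun_prop) _ _)
      rw [norm_mul, hEn]
      have := hmod r θ hr1 hr2 (Set.Ioc_subset_Icc_self hθ)
      calc _ ≤ (η + B*θ^2) * ((r^m)⁻¹ * Real.exp (m * Real.cos θ)) := by gcongr
        _ = _ := by ring
    refine this.trans ?_
    rw [intervalIntegral.integral_const_mul]
    gcongr
    exact gauss_bound m hm η B hη.le hB
  have hb3 : ‖I3‖ ≤ (r^m)⁻¹ * Real.pi := by
    have : ∀ θ ∈ Set.uIoc (Real.pi/2) (3*Real.pi/2), ‖E θ‖ ≤ (r^m)⁻¹ := by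
      intro θ hθ
      rw [Set.uIoc_of_le hle2] at hθ
      rw [hEn]
      have hc : Real.cos θ ≤ 0 := Real.cos_nonpos_of_pi_div_two_le_of_le hθ.1.le (by linarith [hθ.2])
      have : Real.exp (m * Real.cos θ) ≤ 1 := Real.exp_le_one_iff.2 (by nlinarith)
      nlinarith
    refine (intervalIntegral.norm_integral_le_of_norm_le_const this).trans (le_of_eq ?_)
    rw [show 3*Real.pi/2 - Real.pi/2 = Real.pi by ring, abs_of_pos hpi]
  have hAr : ‖A r‖ ≤ C := by
    have m0 : (r:ℂ) ∈ Dset ε := by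
      have := zc_mem ε r 0 hε hr1 hr2 ⟨by linarith, by linarith⟩
      rwa [zc_zero] at this
    exact (h _ m0.1 m0.2.1 m0.2.2).2.1
  -- scaling
  set M : ℝ := (m.factorial:ℝ)/L^m with hM
  have hMpos : 0 < M := by positivity
  have hMc : (m.factorial:ℂ)/(L:ℂ)^m = (M:ℂ) := by rw [hM]; push_cast; rfl
  set ρ : ℝ := M * (r^m)⁻¹ with hρ
  have hρpos : 0 < ρ := by positivity
  have hρb : ρ ≤ Real.exp 1 * (Real.sqrt m * Real.exp (-(m:ℝ))) := by
    have : ρ = (m.factorial:ℝ)/(m:ℝ)^m := by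
      rw [hρ, hM, ← hLr, mul_pow]; field_simp
    rw [this]; exact fact_bound m hm
  have hpic : (Real.pi:ℂ) ≠ 0 := by exact_mod_cast hpi.ne'
  have hfin : hh * (M:ℂ) - 2 * A r = (M:ℂ)/Real.pi * (I1 + I2 - A r * I3) := by
    rw [← hX, hM]
    have hLc : (L:ℂ) ≠ 0 := by exact_mod_cast hL.ne'
    have hfc : (m.factorial:ℂ) ≠ 0 := by exact_mod_cast m.factorial_ne_zero
    push_cast
    field_simp
  rw [hMc, hfin, norm_mul, norm_div, Complex.norm_real, Complex.norm_real, Real.norm_of_nonneg hMpos.le, Real.norm_of_nonneg hpi.le]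
  have hI : ‖I1 + I2 - A r * I3‖ ≤ ‖I1‖ + ‖I2‖ + C * ‖I3‖ := by
    refine (norm_sub_le _ _).trans ?_
    rw [norm_mul]
    have := norm_add_le I1 I2
    have : ‖A r‖ * ‖I3‖ ≤ C * ‖I3‖ := by gcongr
    linarith
  have hMpi : M/Real.pi ≤ M := div_le_self hMpos.le hpi1
  have hmL : (m:ℝ) ≤ 2 * L := by
    rw [← hLr]; nlinarith
  have hsm : 0 < Real.sqrt m := by positivity
  have hS : 0 ≤ Real.sqrt (Real.pi^3) := Real.sqrt_nonneg _
  have he : Real.exp m * Real.exp (-(m:ℝ)) = 1 := by rw [← Real.exp_add]; simp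
  have t1 : M * ‖I1‖ ≤ Real.exp 1 * (Real.pi*C) * (Real.sqrt m * Real.exp (-(ε/4*m))) := by
    calc M * ‖I1‖ ≤ M * ((r^m)⁻¹ * (C * Real.exp ((r - ε/2)*L)) * Real.pi) := by gcongr
      _ = ρ * (C * Real.exp ((r - ε/2)*L) * Real.pi) := by rw [hρ]; ring
      _ ≤ (Real.exp 1 * (Real.sqrt m * Real.exp (-(m:ℝ)))) * (C * Real.exp ((m:ℝ) + -(ε/4*m)) * Real.pi) := by
        gcongr
        rw [sub_mul, mul_comm r, hLr]
        nlinarith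
      _ = Real.exp 1 * (Real.pi*C) * (Real.sqrt m * Real.exp (-(ε/4*m))) * (Real.exp m * Real.exp (-(m:ℝ))) := by
        rw [Real.exp_add]; ring
      _ = _ := by rw [he, mul_one]
  have t2 : M * ‖I2‖ ≤ Real.exp 1 * Real.sqrt (Real.pi^3) * (η + B*Real.pi^2/m) := by
    calc M * ‖I2‖ ≤ M * ((r^m)⁻¹ * (Real.exp m * ((η + B*Real.pi^2/m) * (Real.sqrt (Real.pi^3) / Real.sqrt m)))) := by gcongr
      _ = ρ * (Real.exp m * ((η + B*Real.pi^2/m) * (Real.sqrt (Real.pi^3) / Real.sqrt m))) := by rw [hρ]; ring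
      _ ≤ (Real.exp 1 * (Real.sqrt m * Real.exp (-(m:ℝ)))) * (Real.exp m * ((η + B*Real.pi^2/m) * (Real.sqrt (Real.pi^3) / Real.sqrt m))) := by
        gcongr
      _ = Real.exp 1 * Real.sqrt (Real.pi^3) * (η + B*Real.pi^2/m) * (Real.exp m * Real.exp (-(m:ℝ))) * (Real.sqrt m / Real.sqrt m) := by ring
      _ = _ := by rw [he, mul_one, div_self hsm.ne', mul_one]
  have t3 : M * (C * ‖I3‖) ≤ Real.exp 1 * (Real.pi*C) * (Real.sqrt m * Real.exp (-(1*(m:ℝ)))) := by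
    calc M * (C * ‖I3‖) ≤ M * (C * ((r^m)⁻¹ * Real.pi)) := by gcongr
      _ = ρ * (C * Real.pi) := by rw [hρ]; ring
      _ ≤ (Real.exp 1 * (Real.sqrt m * Real.exp (-(m:ℝ)))) * (C * Real.pi) := by gcongr
      _ = _ := by rw [one_mul]; ring
  have x1 : 0 ≤ Real.exp 1 * (Real.pi*C) := by positivity
  have x2 : 0 ≤ Real.exp 1 * Real.sqrt (Real.pi^3) := by positivity
  have y1 : 0 ≤ Real.sqrt m * Real.exp (-(ε/4*m)) := by positivity
  have y2 : 0 ≤ η + B*Real.pi^2/m := by positivity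
  have y3 : 0 ≤ Real.sqrt m * Real.exp (-(1*(m:ℝ))) := by positivity
  calc M/Real.pi * ‖I1 + I2 - A r * I3‖ ≤ M * (‖I1‖ + ‖I2‖ + C * ‖I3‖) := by gcongr
    _ = M * ‖I1‖ + M * ‖I2‖ + M * (C * ‖I3‖) := by ring
    _ ≤ _ := by
      have q1 := mul_nonneg x2 y1
      have q2 := mul_nonneg x1 y2
      have q3 := mul_nonneg x2 y3
      rw [mul_add]
      simp only [add_mul]
      linarith

lemma extraction (ε : ℝ) (hε : 0 < ε) (hε1 : ε < 1) (δ : ℝ) (hδ : 0 < δ) : ∃ M0 : ℕ,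
    ∀ n m g : ℕ, 2 ≤ n → n = m + 2*g → M0 ≤ m → ε ≤ (m:ℝ)/Real.log n → (m:ℝ)/Real.log n ≤ 2 →
    ‖(Q (n+1)).coeff g / (6^n * (n.factorial:ℂ)) * ((m.factorial:ℂ)/(Real.log n:ℂ)^m) - 2 * A (((m:ℝ)/Real.log n : ℝ):ℂ)‖ < δ := by
  obtain ⟨C, hC, h⟩ := main_bound ε hε hε1
  have hη : 0 < δ/(2*(C+1)) := by positivity
  obtain ⟨B, hB, hb⟩ := h _ hη
  have h1 := (tendsto_sqrt_exp (ε/4) (by linarith)).const_mul C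
  have h2 := ((tendsto_const_div_atTop_nhds_zero_nat B).const_add (δ/(2*(C+1)))).const_mul C
  have h3 := (tendsto_sqrt_exp 1 one_pos).const_mul C
  have h4 := (h1.add h2).add h3
  have hlt : C*0 + C*(δ/(2*(C+1))+0) + C*0 < δ := by
    have : C*0 + C*(δ/(2*(C+1))+0) + C*0 = C*δ/(2*(C+1)) := by ring
    rw [this, div_lt_iff₀ (by positivity)]
    nlinarith
  obtain ⟨M0, hM0⟩ := eventually_atTop.1 (h4.eventually_lt_const hlt)
  refine ⟨max M0 1, fun n m g hn hnm hm hr1 hr2 => ?_⟩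
  exact (hb n m g hn hnm (le_of_max_le_right hm) hr1 hr2).trans_lt (hM0 m (le_of_max_le_left hm))

end CubicMaps

namespace CubicMaps

noncomputable def Kf (x : ℝ) : ℝ := Real.sqrt 2 * x^2 * (A (x:ℂ)).re

lemma Kf_analyticAt (x : ℝ) (hx : x ∈ Set.Ioo (0:ℝ) 2) : AnalyticAt ℝ Kf x := by
  have h := (A_analyticAt x hx).re_ofReal
  unfold Kf
  exact (analyticAt_const.mul (analyticAt_id.pow 2)).mul h

lemma ratio_aux (q c L a S F6 Fn Fm : ℝ) (m n : ℕ) (hn : 1 ≤ n) (hL : 0 < L) (hm : 0 < (m:ℝ)) (hc : c = m/L) (ha : 0 < a)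
    (hS : S^2 = 2) (hS0 : 0 < S) (h6 : 0 < F6) (hFn : 0 < Fn) (hFm : 0 < Fm) :
    (q/(3*n+2)) / ((S/3) * (S * c^2 * a) * (L/m)^2 * F6 * (Fn/Fm) * L^m)
      = (1 - 2/(3*n+2)) * ((q/(F6*(n*Fn)) * (Fm/L^m)) / (2*a)) := by
  have hn0 : (0:ℝ) < n := by exact_mod_cast hn
  have e : (S/3) * (S * c^2 * a) * (L/m)^2 * F6 * (Fn/Fm) * L^m = 2*a/3 * F6 * (Fn/Fm) * L^m := by
    rw [hc]
    have : (S/3) * (S * ((m:ℝ)/L)^2 * a) * (L/m)^2 = S^2 * a/3 := by field_simp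
    rw [this, hS]
  rw [e]
  field_simp
  ring

end CubicMaps

open CubicMaps in
theorem cubic_maps_high_genus_asymptotic
    (H : ℤ → ℤ → ℚ)
    (hH1 : ∀ g : ℤ, H (-1) g = if g = 0 then 1/2 else 0)
    (hH2 : ∀ g : ℤ, H 0 g = if g = 0 then 2 else 0)
    (hH3 : ∀ n g : ℤ, g < 0 → H n g = 0)
    (hHrec : ∀ n g : ℤ, 1 ≤ n → 0 ≤ g →
      H n g = (4*n*(3*n+2)*(3*n-2)/(n+1)) * H (n-2) (g-1)
        + (4*(3*n+2)/(n+1)) *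
          ∑ k ∈ Finset.Icc (-1 : ℤ) (n-1), ∑ i ∈ Finset.Icc (0 : ℤ) g,
            H k i * H (n-2-k) (g-i)) :
    ∃ K : ℝ → ℝ, (∀ x ∈ Set.Ioo (0 : ℝ) 2, AnalyticAt ℝ K x) ∧
      ∀ ε : ℝ, 0 < ε → ε < 1 →
        ∀ δ : ℝ, 0 < δ → ∃ N : ℕ, ∀ n : ℕ, N ≤ n → ∀ g : ℕ,
          ε ≤ ((n : ℝ) - 2 * (g : ℝ)) / Real.log n →
          ((n : ℝ) - 2 * (g : ℝ)) / Real.log n ≤ 2 - ε →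
          |((H (n : ℤ) (g : ℤ) / (3 * (n : ℚ) + 2) : ℚ) : ℝ) /
              ((Real.sqrt 2 / 3) * K (((n : ℝ) - 2 * (g : ℝ)) / Real.log n) *
                (Real.log n / ((n : ℝ) - 2 * (g : ℝ))) ^ 2 * 6 ^ n *
                ((Nat.factorial (n - 1) : ℝ) / (Nat.factorial (n - 2 * g) : ℝ)) *
                Real.log n ^ (n - 2 * g)) - 1| < δ := by
  refine ⟨Kf, Kf_analyticAt, fun ε hε hε1 δ hδ => ?_⟩
  obtain ⟨M0, hM0⟩ := extraction ε hε hε1 (δ/25) (by positivity)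
  have hlog : Tendsto (fun n : ℕ => Real.log n) atTop atTop :=
    Real.tendsto_log_atTop.comp tendsto_natCast_atTop_atTop
  obtain ⟨N1, hN1⟩ := eventually_atTop.1 (hlog.eventually_ge_atTop ((M0:ℝ)/ε))
  obtain ⟨N2, hN2⟩ := exists_nat_gt (2/δ)
  refine ⟨max N1 (max N2 2), fun n hn g hg1 hg2 => ?_⟩
  have hnN1 : N1 ≤ n := le_of_max_le_left hn
  have hnN2 : N2 ≤ n := le_of_max_le_left (le_of_max_le_right hn)
  have hn2 : 2 ≤ n := le_of_max_le_right (le_of_max_le_right hn)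
  have hL : 0 < Real.log n := Real.log_pos (by exact_mod_cast hn2)
  have hpos : 0 < (n:ℝ) - 2*g := by
    by_contra hc
    push Not at hc
    have := div_nonpos_of_nonpos_of_nonneg hc hL.le
    linarith
  have hgn : 2*g ≤ n := by
    have : (2:ℝ)*g < n := by linarith
    have : 2*g < n := by exact_mod_cast this
    omega
  have hmc : (n:ℝ) - 2*g = ((n-2*g : ℕ):ℝ) := by rw [Nat.cast_sub hgn]; push_cast; ring
  rw [hmc] at hg1 hg2 hpos ⊢
  obtain ⟨m, hm⟩ : ∃ m, m = n - 2*g := ⟨_, rfl⟩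
  rw [← hm] at hg1 hg2 hpos ⊢
  have hnm : n = m + 2*g := by omega
  have hMm : M0 ≤ m := by
    have h1 := hN1 n hnN1
    rw [div_le_iff₀ hε] at h1
    rw [le_div_iff₀ hL] at hg1
    have : (M0:ℝ) ≤ m := by linarith
    exact_mod_cast this
  have key := hM0 n m g hn2 hnm hMm hg1 (by linarith)
  have hcI : (m:ℝ)/Real.log n ∈ Set.Ioo (0:ℝ) 2 := ⟨by linarith, by linarith⟩
  obtain ⟨him, hre⟩ := A_real _ hcI
  set L := Real.log n with hLdef
  set c := (m:ℝ)/L with hc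
  set a := (A (c:ℂ)).re with ha
  have hAa : A (c:ℂ) = (a:ℂ) := by
    apply Complex.ext
    · simp [ha]
    · simp [him]
  have hq := Q_coeff H hH1 hH2 hH3 hHrec (n+1) g
  rw [show ((n+1:ℕ):ℤ)-1 = n by push_cast; ring] at hq
  set q : ℝ := ((H n g : ℚ):ℝ) with hqdef
  rw [show ((H (n:ℤ) (g:ℤ) : ℚ):ℂ) = (q:ℂ) by rw [hqdef]; simp] at hq
  have hfac : (n.factorial:ℝ) = n * ((n-1).factorial:ℝ) := by
    rw [← Nat.mul_factorial_pred (by omega)]; push_cast; rfl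
  set w : ℝ := q/(6^n*(n*((n-1).factorial:ℝ))) * ((m.factorial:ℝ)/L^m) with hw
  have hkey : |w - 2*a| < δ/25 := by
    rw [hq, hAa] at key
    have e : (q:ℂ) / (6^n * (n.factorial:ℂ)) * ((m.factorial:ℂ)/(L:ℂ)^m) - 2 * (a:ℂ) = ((w - 2*a : ℝ):ℂ) := by
      rw [hw, ← hfac]; push_cast; ring
    rwa [e, Complex.norm_real, Real.norm_eq_abs] at key
  have hapos : 0 < a := by linarith
  have hcast : ((H (n:ℤ) (g:ℤ) / (3 * (n:ℚ) + 2) : ℚ) : ℝ) = q/(3*n+2) := by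
    rw [hqdef]; push_cast; ring
  have hKf : Kf c = Real.sqrt 2 * c^2 * a := rfl
  rw [hcast, hKf, ratio_aux q c L a (Real.sqrt 2) (6^n) ((n-1).factorial:ℝ) (m.factorial:ℝ) m n (by omega) hL hpos hc hapos
    (Real.sq_sqrt (by norm_num)) (by positivity) (by positivity) (by positivity) (by positivity)]
  change |(1 - 2/(3*(n:ℝ)+2)) * (w/(2*a)) - 1| < δ
  set s : ℝ := 2/(3*(n:ℝ)+2) with hs
  have hn0 : (0:ℝ) ≤ n := Nat.cast_nonneg n
  have hs0 : 0 < s := by positivity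
  have hs1 : s ≤ 1 := by rw [hs, div_le_one (by positivity)]; linarith
  have hsδ : s < δ/2 := by
    rw [hs, div_lt_iff₀ (by positivity)]
    have h1 : (N2:ℝ) ≤ n := by exact_mod_cast hnN2
    have h2 : 2/δ < n := by linarith
    rw [div_lt_iff₀ hδ] at h2
    nlinarith
  have e : (1-s) * (w/(2*a)) - 1 = (1-s) * ((w-2*a)/(2*a)) - s := by
    field_simp; ring
  have hd : |(w-2*a)/(2*a)| < δ/2 := by
    rw [abs_div, abs_of_pos (show 0 < 2*a by linarith), div_lt_iff₀ (by linarith)]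
    nlinarith
  rw [e]
  calc |(1-s) * ((w-2*a)/(2*a)) - s| ≤ |(1-s) * ((w-2*a)/(2*a))| + |s| := abs_sub _ _
    _ = (1-s) * |(w-2*a)/(2*a)| + s := by rw [abs_mul, abs_of_nonneg (show 0 ≤ 1-s by linarith), abs_of_pos hs0]
    _ < δ := by
      have := abs_nonneg ((w-2*a)/(2*a))
      nlinarith
end

section
/- For all integers n ≥ 2 and all real y with 0 ≤ y ≤ 2, one has h_n(y) ≤ 9n, where h_n(y) = n^{−y}·J_n(y). -/
open Filter Finset

noncomputable def ff (y : ℝ) (n : ℕ) : ℝ := ∏ k ∈ Finset.Ico 2 n, (1 + (1 + y) / (k : ℝ))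

lemma ff_two (y : ℝ) : ff y 2 = 1 := by simp [ff]

lemma ff_succ (y : ℝ) (n : ℕ) (hn : 2 ≤ n) : ff y (n+1) = ff y n * (1 + (1+y)/(n:ℝ)) := by
  unfold ff
  rw [Finset.prod_Ico_succ_top hn]

lemma ff_pos (y : ℝ) (hy : 0 ≤ y) (n : ℕ) : 0 < ff y n := by
  unfold ff
  apply Finset.prod_pos
  intro k hk
  positivity

lemma ff_mono (y : ℝ) (hy : 0 ≤ y) (a b : ℕ) (ha : 2 ≤ a) (hab : a ≤ b) : ff y a ≤ ff y b := by
  induction b, hab using Nat.le_induction with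
  | base => exact le_refl _
  | succ n hn ih =>
    rw [ff_succ y n (by omega)]
    have h1 := ff_pos y hy n
    have h2 : 0 ≤ (1+y)/(n:ℝ) := by positivity
    nlinarith

lemma ff_le_cubic (y : ℝ) (hy : 0 ≤ y) (hy2 : y ≤ 2) (n : ℕ) (hn : 2 ≤ n) :
    ff y n ≤ n * (n+1) * (n+2) / 24 := by
  induction n, hn using Nat.le_induction with
  | base => rw [ff_two]; norm_num
  | succ n hn ih =>
    rw [ff_succ y n hn]
    have hn0 : (0:ℝ) < n := by exact_mod_cast (by omega : 0 < n)
    have h3 : 1 + (1+y)/(n:ℝ) ≤ 1 + 3/(n:ℝ) := by gcongr; linarith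
    calc ff y n * (1 + (1+y)/(n:ℝ)) ≤ (n * (n+1) * (n+2) / 24) * (1 + 3/(n:ℝ)) := by
          apply mul_le_mul ih h3 (by positivity) (by positivity)
      _ = _ := by push_cast; field_simp; ring

lemma ff_le_rpow (y : ℝ) (hy : 0 ≤ y) (n : ℕ) (hn : 2 ≤ n) :
    ff y n ≤ ((n:ℝ)/2) ^ (1+y) := by
  induction n, hn using Nat.le_induction with
  | base => rw [ff_two]; norm_num
  | succ n hn ih =>
    rw [ff_succ y n hn]
    have hn0 : (0:ℝ) < n := by exact_mod_cast (by omega : 0 < n)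
    have h3 : 1 + (1+y)*(1/(n:ℝ)) ≤ (1 + 1/(n:ℝ)) ^ (1+y) :=
      one_add_mul_self_le_rpow_one_add (by have : 0 < 1/(n:ℝ) := by positivity
                                           linarith) (by linarith)
    have h4 : 1 + (1+y)/(n:ℝ) ≤ (1 + 1/(n:ℝ)) ^ (1+y) := by
      rw [mul_one_div] at h3; exact h3
    calc ff y n * (1 + (1+y)/(n:ℝ)) ≤ ((n:ℝ)/2) ^ (1+y) * (1 + 1/(n:ℝ)) ^ (1+y) := by
          apply mul_le_mul ih h4 (by positivity) (by positivity)
      _ = (((n:ℝ)/2) * (1 + 1/(n:ℝ))) ^ (1+y) := by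
          rw [Real.mul_rpow (by positivity) (by positivity)]
      _ = _ := by congr 1; push_cast; field_simp

lemma cb_bound (k : ℕ) (hk : 4 ≤ k) : 3*k*(k+1)*(k+2)*2 ≤ 11 * Nat.centralBinom k := by
  induction k, hk using Nat.le_induction with
  | base => decide
  | succ k hk ih =>
    have h := Nat.succ_mul_centralBinom_succ k
    have h2 : (k+1) * (3*(k+1)*(k+1+1)*(k+1+2)*2) ≤ (k+1) * (11 * Nat.centralBinom (k+1)) := by
      calc (k+1) * (3*(k+1)*(k+1+1)*(k+1+2)*2)
          ≤ 2*(2*k+1) * (3*k*(k+1)*(k+2)*2) := by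
            obtain ⟨t, rfl⟩ := Nat.exists_eq_add_of_le hk
            ring_nf; nlinarith [Nat.zero_le t]
        _ ≤ 2*(2*k+1) * (11 * Nat.centralBinom k) := Nat.mul_le_mul_left _ ih
        _ = 11 * ((k+1) * Nat.centralBinom (k+1)) := by rw [h]; ring
        _ = _ := by ring
    exact Nat.le_of_mul_le_mul_left h2 (by omega)

lemma ch_bound7 (m k : ℕ) (hm : 7 ≤ m) (hk : 2 ≤ k) (hkm : 2*k ≤ m) :
    3*k*(k+1)*(k+2)*2 ≤ 11 * m.choose k := by
  rcases Nat.lt_or_ge k 4 with h | h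
  · have := Nat.choose_le_choose k hm
    have h7 : 3*k*(k+1)*(k+2)*2 ≤ 11 * (7:ℕ).choose k := by
      interval_cases k <;> decide
    omega
  · have := Nat.choose_le_choose k hkm
    have h2 := cb_bound k h
    rw [Nat.centralBinom] at h2
    omega

lemma ch_bound3 (m k : ℕ) (hm : 3 ≤ m) (hm6 : m ≤ 6) (hk : 2 ≤ k) (hkm : 2*k ≤ m) :
    3*k*(k+1)*(k+2) ≤ 12 * m.choose k := by
  have hk3 : k ≤ 3 := by omega
  interval_cases k <;> interval_cases m <;> first | omega | decide

lemma middle_term (y D c : ℝ) (J : ℕ → ℝ) (hy : 0 ≤ y) (hy2 : y ≤ 2) (hD0 : 0 ≤ D) (hD : D ≤ 72)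
    (hJ : ∀ n, 0 ≤ J n) (hJ1 : J 1 ≤ 85/3) (m k : ℕ) (hm : 3 ≤ m) (hk : 1 ≤ k) (hkm : 2*k ≤ m)
    (ih : ∀ i, 2 ≤ i → i ≤ m → J i ≤ D * ff y i)
    (hc : (m ≤ 6 ∧ c = 12) ∨ (7 ≤ m ∧ c = 11/2)) :
    J k * J (m-k) / (m.choose k) ≤ c * (D * ff y (m-1)) := by
  have hch : (0:ℝ) < m.choose k := by exact_mod_cast Nat.choose_pos (by omega)
  have hJk : J k ≤ c * m.choose k := by
    rcases Nat.lt_or_ge k 2 with h | h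
    · have : k = 1 := by omega
      subst this
      rw [Nat.choose_one_right]
      rcases hc with ⟨h1, rfl⟩ | ⟨h1, rfl⟩
      · have : (3:ℝ) ≤ m := by exact_mod_cast hm
        linarith
      · have : (7:ℝ) ≤ m := by exact_mod_cast h1
        linarith
    · have h1 := ih k h (by omega)
      have h2 := ff_le_cubic y hy hy2 k h
      have h4 : J k ≤ 3*k*(k+1)*(k+2) := by
        have : D * ff y k ≤ 72 * (k * (k+1) * (k+2) / 24) :=
          mul_le_mul hD h2 (ff_pos y hy k).le (by norm_num)
        linarith
      rcases hc with ⟨h5, rfl⟩ | ⟨h5, rfl⟩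
      · have h6 : (3*k*(k+1)*(k+2) : ℝ) ≤ 12 * m.choose k := by
          exact_mod_cast ch_bound3 m k hm h5 h hkm
        linarith
      · have h6 : (3*k*(k+1)*(k+2)*2 : ℝ) ≤ 11 * m.choose k := by
          exact_mod_cast ch_bound7 m k h5 h hkm
        linarith
  have hJm : J (m-k) ≤ D * ff y (m-1) := by
    refine (ih (m-k) (by omega) (by omega)).trans ?_
    exact mul_le_mul_of_nonneg_left (ff_mono y hy _ _ (by omega) (by omega)) hD0
  rw [div_le_iff₀ hch]
  calc J k * J (m-k) ≤ (c * m.choose k) * (D * ff y (m-1)) :=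
        mul_le_mul hJk hJm (hJ _) ((hJ _).trans hJk)
    _ = _ := by ring

lemma middle_sum (y D c : ℝ) (J : ℕ → ℝ) (hy : 0 ≤ y) (hy2 : y ≤ 2) (hD0 : 0 ≤ D) (hD : D ≤ 72)
    (hJ : ∀ n, 0 ≤ J n) (hJ1 : J 1 ≤ 85/3) (m : ℕ) (hm : 3 ≤ m)
    (ih : ∀ i, 2 ≤ i → i ≤ m → J i ≤ D * ff y i)
    (hc : (m ≤ 6 ∧ c = 12) ∨ (7 ≤ m ∧ c = 11/2)) :
    ∑ k ∈ Finset.range (m+1), J k * J (m-k) / (m.choose k) ≤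
      2 * J 0 * J m + c * (m-1) * (D * ff y (m-1)) := by
  rw [Finset.sum_range_succ]
  obtain ⟨p, rfl⟩ : ∃ p, m = p + 1 := ⟨m-1, by omega⟩
  rw [Finset.sum_range_succ']
  have : ∑ k ∈ Finset.range p, J (k+1) * J (p+1-(k+1)) / ((p+1).choose (k+1)) ≤
      ∑ k ∈ Finset.range p, c * (D * ff y (p+1-1)) := by
    apply Finset.sum_le_sum
    intro k hk
    rw [Finset.mem_range] at hk
    rcases le_total (2*(k+1)) (p+1) with h | h
    · exact middle_term y D c J hy hy2 hD0 hD hJ hJ1 (p+1) (k+1) hm (by omega) h ih hc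
    · have := middle_term y D c J hy hy2 hD0 hD hJ hJ1 (p+1) (p+1-(k+1)) hm (by omega) (by omega) ih hc
      rw [Nat.choose_symm (by omega), show p+1-(p+1-(k+1)) = k+1 by omega] at this
      rwa [mul_comm (J (k+1))]
  rw [Finset.sum_const, Finset.card_range, nsmul_eq_mul] at this
  simp only [Nat.choose_zero_right, Nat.choose_self, Nat.cast_one, div_one, Nat.sub_self, Nat.sub_zero,
    Nat.add_sub_add_right, Nat.add_sub_cancel] at this ⊢
  push_cast
  linarith

lemma poly_big (n y : ℝ) (hn : 9 ≤ n) (hy : 0 ≤ y) (hy2 : y ≤ 2) :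
    ((9*n^2-4)*n+4*y^2*(3*n+2))*(n-2+y)*(n-2)+6*y*(3*n+2)*(n-1)*(n-2+y)*(n-1+y)
      +(11/2)*(3*n+2)*(n-3)^2*(n-2) ≤ 9*(n+1)*n*(n-2+y)*(n-1+y)*(n+y) := by
  obtain ⟨s, rfl⟩ : ∃ s, n = s + 9 := ⟨n-9, by ring⟩
  have hs : 0 ≤ s := by linarith
  have y2 : y^2 ≤ 2*y := by nlinarith
  have y3 : y^3 ≤ 4*y := by nlinarith
  have c0 : 0 ≤ 48321 + 31083*y - 7124*y^2 - 1394*y^3 := by linarith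
  have c1 : 0 ≤ s * (19279 + 11047*y - 3232*y^2 - 347*y^3) := mul_nonneg hs (by linarith)
  have c2 : 0 ≤ s^2 * (5265/2 + 1303*y - 461*y^2 - 21*y^3) := mul_nonneg (by positivity) (by linarith)
  have c3 : 0 ≤ s^3 * (134 + 51*y - 21*y^2) := mul_nonneg (by positivity) (by linarith)
  have c4 : 0 ≤ s^4 * (3/2) := by positivity
  linarith

lemma poly_small (m : ℕ) (hm3 : 3 ≤ m) (hm6 : m ≤ 6) (n y : ℝ) (hn : n = m + 2) (hy : 0 ≤ y) (hy2 : y ≤ 2) :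
    ((9*n^2-4)*n+4*y^2*(3*n+2))*(n-2+y)*(n-2)+6*y*(3*n+2)*(n-1)*(n-2+y)*(n-1+y)
      +12*(3*n+2)*(n-3)^2*(n-2) ≤ 9*(n+1)*n*(n-2+y)*(n-1+y)*(n+y) := by
  have y2 : y^2 ≤ 2*y := by nlinarith
  have y3 : y^3 ≤ 4*y := by nlinarith
  subst hn
  interval_cases m <;> push_cast <;> ring_nf <;> linarith

lemma step_ineq (n y c x : ℝ) (hn : 5 ≤ n) (hx : 0 ≤ x)
    (h : ((9*n^2-4)*n+4*y^2*(3*n+2))*(n-2+y)*(n-2)+6*y*(3*n+2)*(n-1)*(n-2+y)*(n-1+y)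
      +c*(3*n+2)*(n-3)^2*(n-2) ≤ 9*(n+1)*n*(n-2+y)*(n-1+y)*(n+y)) :
    (9*n^2-4)/(9*(n^2-1)) * (x * (1+(1+y)/(n-3)))
     + (3*n+2)/(9*(n+1)*n*(n-1)) * (4*y^2*(x * (1+(1+y)/(n-3))) + c*(n-3)*x)
     + 2*y*(3*n+2)/(3*n*(n+1)) * (x * (1+(1+y)/(n-3)) * (1+(1+y)/(n-2)))
    ≤ x * (1+(1+y)/(n-3)) * (1+(1+y)/(n-2)) * (1+(1+y)/(n-1)) := by
  have e1 : n - 1 ≠ 0 := by linarith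
  have e2 : n - 2 ≠ 0 := by linarith
  have e3 : n - 3 ≠ 0 := by linarith
  have e4 : n + 1 ≠ 0 := by linarith
  have e5 : n ≠ 0 := by linarith
  have e6 : n^2 - 1 ≠ 0 := by nlinarith
  have p1 : 0 < n - 1 := by linarith
  have p2 : 0 < n - 2 := by linarith
  have p3 : 0 < n - 3 := by linarith
  have p4 : 0 < n + 1 := by linarith
  have p5 : 0 < n := by linarith
  rw [← sub_nonneg]
  have : x * (1+(1+y)/(n-3)) * (1+(1+y)/(n-2)) * (1+(1+y)/(n-1)) -
     ((9*n^2-4)/(9*(n^2-1)) * (x * (1+(1+y)/(n-3)))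
     + (3*n+2)/(9*(n+1)*n*(n-1)) * (4*y^2*(x * (1+(1+y)/(n-3))) + c*(n-3)*x)
     + 2*y*(3*n+2)/(3*n*(n+1)) * (x * (1+(1+y)/(n-3)) * (1+(1+y)/(n-2))))
     = x * (9*(n+1)*n*(n-2+y)*(n-1+y)*(n+y) - (((9*n^2-4)*n+4*y^2*(3*n+2))*(n-2+y)*(n-2)+6*y*(3*n+2)*(n-1)*(n-2+y)*(n-1+y)
      +c*(3*n+2)*(n-3)^2*(n-2))) / (9*(n+1)*n*(n-1)*(n-2)*(n-3)) := by
    rw [show n^2-1 = (n-1)*(n+1) by ring]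
    field_simp
    ring
  rw [this]
  apply div_nonneg
  · exact mul_nonneg hx (by linarith)
  · positivity

set_option maxHeartbeats 2000000 in
lemma core (y D : ℝ) (J : ℕ → ℝ) (hy : 0 ≤ y) (hy2 : y ≤ 2) (hD18 : 18 ≤ D) (hD : D ≤ 72)
    (hDy : 50.4*y - 28.8 ≤ D)
    (hJ : ∀ n, 0 ≤ J n) (hJ0 : J 0 = 2*y^2) (hJ1 : J 1 ≤ 5/6*y + 10/3*y^3)
    (hrec : ∀ m : ℕ, ∀ n : ℝ, n = m + 2 → J (m+2) ≤ (9*n^2-4)/(9*(n^2-1)) * J m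
      + (3*n+2)/(9*(n+1)*n*(n-1)) * (∑ k ∈ Finset.range (m+1), J k * J (m-k) / (m.choose k))
      + 2*y*(3*n+2)/(3*n*(n+1)) * J (m+1)) :
    ∀ n, 2 ≤ n → J n ≤ D * ff y n := by
  have y2 : y^2 ≤ 2*y := by nlinarith
  have y3 : y^3 ≤ 4*y := by nlinarith
  have hJ1' : J 1 ≤ 85/6*y := by linarith
  have hJ1'' : J 1 ≤ 85/3 := by linarith
  have hD0 : 0 ≤ D := by linarith
  have J2 : J 2 ≤ D := by
    have h := hrec 0 2 (by norm_num)
    simp [hJ0] at h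
    norm_num at h
    have h1 : y * J 1 ≤ y * (5/6*y + 10/3*y^3) := mul_le_mul_of_nonneg_left hJ1 hy
    have h2 : J 2 ≤ 28/9*y^2 + 32/9*y^4 := by linarith
    refine h2.trans ?_
    rcases le_total y 1.2 with h3 | h3
    · have : y^2 ≤ 1.44 := by nlinarith
      have : y^4 ≤ 2.0736 := by nlinarith [sq_nonneg y]
      linarith
    · have a1 : 0 ≤ (y-1.2)*(2-y) := mul_nonneg (by linarith) (by linarith)
      have a2 : 0 ≤ (y-1.2)*(2-y) * (y^2+3.2*y) := mul_nonneg a1 (by positivity)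
      nlinarith
  have f3 : ff y 3 = (3+y)/2 := by
    rw [ff_succ y 2 (by norm_num), ff_two]; push_cast; ring
  have f4 : ff y 4 = (3+y)/2*((4+y)/3) := by
    rw [ff_succ y 3 (by norm_num), f3]; push_cast; ring
  have J3 : J 3 ≤ D * ff y 3 := by
    rw [f3]
    have h := hrec 1 3 (by norm_num)
    simp [hJ0, Finset.sum_range_succ] at h
    norm_num at h
    have h1 : y * J 2 ≤ y * D := mul_le_mul_of_nonneg_left J2 hy
    have h2 : y^2 * J 1 ≤ y^2 * (5/6*y + 10/3*y^3) := mul_le_mul_of_nonneg_left hJ1 (by positivity)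
    have h4 : J 3 ≤ (77/72) * (5/6*y + 10/3*y^3) + 11/54 * (y^2 * (5/6*y + 10/3*y^3)) + 11/18*(y*D) := by
      linarith
    refine h4.trans ?_
    have key : (77/72) * (5/6*y + 10/3*y^3) + 11/54 * (y^2 * (5/6*y + 10/3*y^3)) ≤ D * (1.5 - y/9) := by
      rcases le_total y 1.5 with h3 | h3
      · have b2 : y^2 ≤ 2.25 := by nlinarith
        have b3 : y^3 ≤ 3.375 := by nlinarith
        have b5 : y^5 ≤ 7.6 := by nlinarith [mul_nonneg hy hy, pow_nonneg hy 3]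
        have : 18 * (1.5 - y/9) ≤ D * (1.5 - y/9) := mul_le_mul_of_nonneg_right hD18 (by linarith)
        linarith
      · have b3 : y^3 ≤ 8 := by nlinarith
        have b5 : y^5 ≤ 32 := by nlinarith [mul_nonneg hy hy, pow_nonneg hy 3]
        have : (50.4*y - 28.8) * (1.5 - y/9) ≤ D * (1.5 - y/9) := mul_le_mul_of_nonneg_right hDy (by linarith)
        have : D * (1.5 - 2/9) ≤ D * (1.5 - y/9) := mul_le_mul_of_nonneg_left (by linarith) hD0
        nlinarith [pow_nonneg hy 3]
    linarith
  have J4 : J 4 ≤ D * ff y 4 := by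
    rw [f3] at J3
    rw [f4]
    have h := hrec 2 4 (by norm_num)
    simp [hJ0, Finset.sum_range_succ] at h
    norm_num at h
    have h1 : y * J 3 ≤ y * (D*((3+y)/2)) := mul_le_mul_of_nonneg_left J3 hy
    have h2 : y^2 * J 2 ≤ y^2 * D := mul_le_mul_of_nonneg_left J2 (by positivity)
    have h3 : J 1 * J 1 ≤ 85/3 * (85/3) := mul_le_mul hJ1'' hJ1'' (hJ 1) (by norm_num)
    have h5 : J 4 ≤ 28/27 * D + 14/540 * (4 * (y^2 * D) + 85/3*(85/3)/2) + 7/15*(y * (D*((3+y)/2))) := by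
      linarith
    refine h5.trans ?_
    have : 18 * ((3+y)/2*((4+y)/3) - 28/27 - 14/540*4*y^2 - 7/15*y*((3+y)/2)) ≤ D * ((3+y)/2*((4+y)/3) - 28/27 - 14/540*4*y^2 - 7/15*y*((3+y)/2)) :=
      mul_le_mul_of_nonneg_right hD18 (by nlinarith)
    nlinarith
  intro n
  induction n using Nat.strong_induction_on with
  | _ n ih =>
    intro hn
    rcases Nat.lt_or_ge n 5 with h | h
    · interval_cases n
      · rw [ff_two]; linarith
      · exact J3
      · exact J4
    · obtain ⟨m, rfl⟩ : ∃ m, n = m + 2 := ⟨n-2, by omega⟩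
      have hm : 3 ≤ m := by omega
      have hm' : (3:ℝ) ≤ m := by exact_mod_cast hm
      obtain ⟨c, hc, hpoly⟩ : ∃ c : ℝ, ((m ≤ 6 ∧ c = 12) ∨ (7 ≤ m ∧ c = 11/2)) ∧ ∀ n : ℝ, n = m + 2 →
        ((9*n^2-4)*n+4*y^2*(3*n+2))*(n-2+y)*(n-2)+6*y*(3*n+2)*(n-1)*(n-2+y)*(n-1+y)
          +c*(3*n+2)*(n-3)^2*(n-2) ≤ 9*(n+1)*n*(n-2+y)*(n-1+y)*(n+y) := by
        rcases Nat.lt_or_ge m 7 with h7 | h7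
        · exact ⟨12, Or.inl ⟨by omega, rfl⟩, fun n hn => poly_small m hm (by omega) n y hn hy hy2⟩
        · refine ⟨11/2, Or.inr ⟨h7, rfl⟩, fun n hn => poly_big n y ?_ hy hy2⟩
          have : (7:ℝ) ≤ m := by exact_mod_cast h7
          linarith
      have hs := middle_sum y D c J hy hy2 hD0 hD hJ hJ1'' m hm
        (fun i hi him => ih i (by omega) hi) hc
      obtain ⟨N, hN⟩ : ∃ N : ℝ, N = m + 2 := ⟨_, rfl⟩
      have hr := hrec m N hN
      have hst := step_ineq N y c (D * ff y (m-1)) (by linarith)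
        (mul_nonneg hD0 (ff_pos y hy _).le) (hpoly N hN)
      have g1 : ff y m = ff y (m-1) * (1+(1+y)/(N-3)) := by
        have := ff_succ y (m-1) (by omega)
        rw [show m-1+1 = m by omega, Nat.cast_sub (by omega)] at this
        rw [this, hN]; congr 3; push_cast; ring
      have g2 : ff y (m+1) = ff y m * (1+(1+y)/(N-2)) := by
        rw [ff_succ y m (by omega), hN]; congr 3; ring
      have g3 : ff y (m+2) = ff y (m+1) * (1+(1+y)/(N-1)) := by
        rw [ff_succ y (m+1) (by omega), hN]; congr 3; push_cast; ring
      have i1 := ih m (by omega) (by omega)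
      have i2 := ih (m+1) (by omega) (by omega)
      have k1 : D * ff y (m-1) * (1+(1+y)/(N-3)) = D * ff y m := by rw [g1]; ring
      have k2 : D * ff y m * (1+(1+y)/(N-2)) = D * ff y (m+1) := by rw [g2]; ring
      have k3 : D * ff y (m+1) * (1+(1+y)/(N-1)) = D * ff y (m+2) := by rw [g3]; ring
      rw [k1, k2, k3] at hst
      refine hr.trans (le_trans ?_ hst)
      have hN5 : 5 ≤ N := by linarith
      have q1 : 0 < N - 1 := by linarith
      have q2 : 0 ≤ 9*N^2-4 := by nlinarith
      have q3 : 0 < N^2-1 := by nlinarith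
      have q4 : 0 < N := by linarith
      have q5 : ∑ k ∈ Finset.range (m+1), J k * J (m-k) / (m.choose k) ≤
          4*y^2*(D * ff y m) + c*(N-3)*(D * ff y (m-1)) := by
        have : 2 * J 0 * J m ≤ 4*y^2*(D * ff y m) := by
          rw [hJ0]
          nlinarith [mul_le_mul_of_nonneg_left i1 (sq_nonneg y)]
        have e : N - 3 = m - 1 := by rw [hN]; ring
        rw [e]; linarith
      gcongr

lemma H_nonneg (H : ℤ → ℤ → ℚ)
    (hH1 : ∀ g : ℤ, H (-1) g = if g = 0 then 1/2 else 0)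
    (hH2 : ∀ g : ℤ, H 0 g = if g = 0 then 2 else 0)
    (hH3 : ∀ n g : ℤ, g < 0 → H n g = 0)
    (hHrec : ∀ n g : ℤ, 1 ≤ n → 0 ≤ g →
      H n g = (4*n*(3*n+2)*(3*n-2)/(n+1)) * H (n-2) (g-1)
        + (4*(3*n+2)/(n+1)) *
          ∑ k ∈ Finset.Icc (-1 : ℤ) (n-1), ∑ i ∈ Finset.Icc (0 : ℤ) g,
            H k i * H (n-2-k) (g-i)) :
    ∀ N : ℕ, ∀ g : ℤ, 0 ≤ H ((N:ℤ)-1) g := by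
  intro N
  induction N using Nat.strong_induction_on with
  | _ N ih =>
    intro g
    have ih' : ∀ k : ℤ, -1 ≤ k → k < (N:ℤ)-1 → ∀ g, 0 ≤ H k g := by
      intro k hk1 hk2 g
      have := ih (k+1).toNat (by omega) g
      rwa [show (((k+1).toNat : ℕ):ℤ) - 1 = k by omega] at this
    rcases Nat.lt_or_ge N 2 with h | h
    · interval_cases N
      · norm_num; rw [hH1]; split_ifs <;> norm_num
      · norm_num; rw [hH2]; split_ifs <;> norm_num
    · rcases lt_or_ge g 0 with hg | hg
      · rw [hH3 _ _ hg]
      · obtain ⟨n, hn⟩ : ∃ n : ℤ, n = (N:ℤ)-1 := ⟨_, rfl⟩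
        rw [← hn] at ih' ⊢
        have hn1 : 1 ≤ n := by omega
        have hq : (1:ℚ) ≤ n := by exact_mod_cast hn1
        have q1 : (0:ℚ) ≤ 3*n-2 := by linarith
        have q0 : (0:ℚ) ≤ n := by linarith
        rw [hHrec n g hn1 hg]
        apply add_nonneg
        · exact mul_nonneg (by positivity) (ih' _ (by omega) (by omega) _)
        · apply mul_nonneg (by positivity)
          apply Finset.sum_nonneg
          intro k hk
          apply Finset.sum_nonneg
          intro i hi
          rw [Finset.mem_Icc] at hk
          exact mul_nonneg (ih' _ (by omega) (by omega) _) (ih' _ (by omega) (by omega) _)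

lemma H_vanish (H : ℤ → ℤ → ℚ)
    (hH1 : ∀ g : ℤ, H (-1) g = if g = 0 then 1/2 else 0)
    (hH2 : ∀ g : ℤ, H 0 g = if g = 0 then 2 else 0)
    (hHrec : ∀ n g : ℤ, 1 ≤ n → 0 ≤ g →
      H n g = (4*n*(3*n+2)*(3*n-2)/(n+1)) * H (n-2) (g-1)
        + (4*(3*n+2)/(n+1)) *
          ∑ k ∈ Finset.Icc (-1 : ℤ) (n-1), ∑ i ∈ Finset.Icc (0 : ℤ) g,
            H k i * H (n-2-k) (g-i)) :
    ∀ N : ℕ, ∀ g : ℤ, (N:ℤ)-1+2 ≤ 2*g → H ((N:ℤ)-1) g = 0 := by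
  intro N
  induction N using Nat.strong_induction_on with
  | _ N ih =>
    intro g hg
    have ih' : ∀ k : ℤ, -1 ≤ k → k < (N:ℤ)-1 → ∀ g, k+2 ≤ 2*g → H k g = 0 := by
      intro k hk1 hk2 g hg
      have := ih (k+1).toNat (by omega) g (by omega)
      rwa [show (((k+1).toNat : ℕ):ℤ) - 1 = k by omega] at this
    rcases Nat.lt_or_ge N 2 with h | h
    · interval_cases N
      · norm_num; rw [hH1, if_neg (by omega)]
      · norm_num; rw [hH2, if_neg (by push_cast at hg; omega)]
    · obtain ⟨n, hn⟩ : ∃ n : ℤ, n = (N:ℤ)-1 := ⟨_, rfl⟩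
      rw [← hn] at ih' hg ⊢
      have hn1 : 1 ≤ n := by omega
      rw [hHrec n g hn1 (by omega), ih' (n-2) (by omega) (by omega) (g-1) (by omega),
        Finset.sum_eq_zero, mul_zero, mul_zero, add_zero]
      intro k hk
      apply Finset.sum_eq_zero
      intro i hi
      rw [Finset.mem_Icc] at hk
      rcases le_or_gt (k+2) (2*i) with h1 | h1
      · rw [ih' k (by omega) (by omega) i h1, zero_mul]
      · rw [ih' (n-2-k) (by omega) (by omega) (g-i) (by omega), mul_zero]

/-- truncated generating polynomial -/
noncomputable def TT (H : ℤ → ℤ → ℚ) (y : ℝ) (M : ℤ) (k : ℤ) : ℝ :=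
  ∑ g ∈ Finset.Icc (0:ℤ) M, ((H k g : ℚ) : ℝ) * y ^ (k + 2 - 2 * g)

lemma cauchy_le (M : ℤ) (a b : ℤ → ℝ) (ha : ∀ i, 0 ≤ a i) (hb : ∀ i, 0 ≤ b i) :
    ∑ g ∈ Finset.Icc (0:ℤ) M, ∑ i ∈ Finset.Icc (0:ℤ) g, a i * b (g-i) ≤
      (∑ g ∈ Finset.Icc (0:ℤ) M, a g) * (∑ g ∈ Finset.Icc (0:ℤ) M, b g) := by
  rw [Finset.sum_mul_sum, ← Finset.sum_product', Finset.sum_sigma']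
  rw [← Finset.sum_image (s := (Finset.Icc (0:ℤ) M).sigma fun g => Finset.Icc (0:ℤ) g)
    (g := fun p => ((p.2, p.1 - p.2) : ℤ × ℤ)) (f := fun q : ℤ × ℤ => a q.1 * b q.2)]
  · apply Finset.sum_le_sum_of_subset_of_nonneg
    · intro q hq
      simp only [Finset.mem_image, Finset.mem_sigma, Finset.mem_Icc, Sigma.exists] at hq
      obtain ⟨g, i, h, rfl⟩ := hq
      simp only [Finset.mem_product, Finset.mem_Icc]
      omega
    · intro q _ _
      exact mul_nonneg (ha _) (hb _)
  · rintro ⟨g, i⟩ _ ⟨g', i'⟩ _ h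
    simp only [Prod.mk.injEq] at h
    obtain ⟨h1, h2⟩ := h
    obtain rfl : g = g' := by omega
    obtain rfl := h1
    rfl

lemma TT_rec (H : ℤ → ℤ → ℚ)
    (hH3 : ∀ n g : ℤ, g < 0 → H n g = 0)
    (hHrec : ∀ n g : ℤ, 1 ≤ n → 0 ≤ g →
      H n g = (4*n*(3*n+2)*(3*n-2)/(n+1)) * H (n-2) (g-1)
        + (4*(3*n+2)/(n+1)) *
          ∑ k ∈ Finset.Icc (-1 : ℤ) (n-1), ∑ i ∈ Finset.Icc (0 : ℤ) g,
            H k i * H (n-2-k) (g-i))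
    (hpos : ∀ k : ℤ, -1 ≤ k → ∀ g, 0 ≤ H k g)
    (y : ℝ) (hy : 0 < y) (M : ℤ) (n : ℤ) (hn : 1 ≤ n) :
    TT H y M n ≤ (4*n*(3*n+2)*(3*n-2)/(n+1)) * TT H y M (n-2)
        + (4*(3*n+2)/(n+1)) *
          ∑ k ∈ Finset.Icc (-1 : ℤ) (n-1), TT H y M k * TT H y M (n-2-k) := by
  have hq : (1:ℝ) ≤ n := by exact_mod_cast hn
  have q1 : (0:ℝ) ≤ 3*n-2 := by linarith
  have q0 : (0:ℝ) ≤ n := by linarith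
  have hr : ∀ k : ℤ, -1 ≤ k → ∀ g, (0:ℝ) ≤ ((H k g : ℚ):ℝ) := fun k hk g => by
    exact_mod_cast hpos k hk g
  have e : TT H y M n = (4*n*(3*n+2)*(3*n-2)/(n+1)) *
      (∑ g ∈ Finset.Icc (0:ℤ) M, ((H (n-2) (g-1) : ℚ):ℝ) * y ^ ((n-2) + 2 - 2 * (g-1)))
      + (4*(3*n+2)/(n+1)) * ∑ k ∈ Finset.Icc (-1 : ℤ) (n-1),
        ∑ g ∈ Finset.Icc (0:ℤ) M, ∑ i ∈ Finset.Icc (0 : ℤ) g,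
          (((H k i : ℚ):ℝ) * y ^ (k+2-2*i)) *
            (((H (n-2-k) (g-i) : ℚ) : ℝ) * y ^ ((n-2-k)+2-2*(g-i))) := by
    rw [Finset.sum_comm, Finset.mul_sum, Finset.mul_sum, ← Finset.sum_add_distrib, TT]
    apply Finset.sum_congr rfl
    intro g hg
    rw [Finset.mem_Icc] at hg
    rw [hHrec n g hn hg.1]
    push_cast
    rw [add_mul, mul_assoc _ _ (y ^ _), mul_assoc _ _ (y ^ _), Finset.sum_mul]
    congr 3
    · congr 1; ring
    · funext k
      rw [Finset.sum_mul]
      apply Finset.sum_congr rfl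
      intro i hi
      rw [show n + 2 - 2*g = (k+2-2*i) + ((n-2-k)+2-2*(g-i)) by ring, zpow_add₀ hy.ne']
      ring
  rw [e]
  apply add_le_add
  · apply mul_le_mul_of_nonneg_left _ (by positivity)
    rw [TT]
    have hs : ∀ g : ℤ, 0 ≤ ((H (n-2) g : ℚ):ℝ) * y ^ ((n-2) + 2 - 2 * g) := fun g =>
      mul_nonneg (hr _ (by omega) _) (zpow_nonneg hy.le _)
    rw [← Finset.sum_image (s := Finset.Icc (0:ℤ) M) (g := fun g : ℤ => g - 1)
      (f := fun g : ℤ => ((H (n-2) g : ℚ):ℝ) * y ^ ((n-2) + 2 - 2 * g))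
      (fun a _ b _ h => by simpa using h)]
    have h0 : ∑ g ∈ (Finset.Icc (0:ℤ) M).image (fun g : ℤ => g - 1),
        ((H (n-2) g : ℚ):ℝ) * y ^ ((n-2) + 2 - 2 * g) ≤
        ∑ g ∈ Finset.Icc (-1:ℤ) M, ((H (n-2) g : ℚ):ℝ) * y ^ ((n-2) + 2 - 2 * g) := by
      apply Finset.sum_le_sum_of_subset_of_nonneg
      · intro x hx
        simp only [Finset.mem_image, Finset.mem_Icc] at hx ⊢
        omega
      · intro i _ _; exact hs i
    refine h0.trans (le_of_eq ?_)
    symm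
    apply Finset.sum_subset
    · intro x hx
      simp only [Finset.mem_Icc] at hx ⊢
      omega
    · intro x hx hx'
      simp only [Finset.mem_Icc] at hx hx'
      rw [hH3 _ _ (by omega)]; simp
  · apply mul_le_mul_of_nonneg_left _ (by positivity)
    apply Finset.sum_le_sum
    intro k hk
    rw [Finset.mem_Icc] at hk
    by_cases hk2 : n - 2 - k < -1
    · omega
    · exact cauchy_le M (fun i => ((H k i : ℚ):ℝ) * y ^ (k+2-2*i))
        (fun i => ((H (n-2-k) i : ℚ):ℝ) * y ^ ((n-2-k)+2-2*i))
        (fun i => mul_nonneg (hr _ (by omega) _) (zpow_nonneg hy.le _))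
        (fun i => mul_nonneg (hr _ (by omega) _) (zpow_nonneg hy.le _))

lemma int_sum (F : ℤ → ℝ) (m : ℕ) :
    ∑ k ∈ Finset.Icc (-1:ℤ) m, F k = F (-1) + ∑ k ∈ Finset.range (m+1), F k := by
  have : Finset.Icc (-1:ℤ) m = (Finset.range (m+2)).image (fun j : ℕ => (j:ℤ)-1) := by
    ext x
    simp only [Finset.mem_Icc, Finset.mem_image, Finset.mem_range]
    constructor
    · intro h; exact ⟨(x+1).toNat, by omega, by omega⟩
    · rintro ⟨a, h, rfl⟩; omega
  rw [this, Finset.sum_image (fun a _ b _ h => by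
    simp only [sub_left_inj, Nat.cast_inj] at h; exact h), Finset.sum_range_succ']
  rw [add_comm]
  simp

/-- normalised sequence -/
noncomputable def JJ (T : ℤ → ℝ) (n : ℕ) : ℝ := (Nat.factorial n : ℝ)⁻¹ * (6:ℝ) ^ (-(n:ℤ)) * T n

lemma T_eq (T : ℤ → ℝ) (n : ℕ) : T n = n.factorial * 6^n * JJ T n := by
  have : (n.factorial : ℝ) ≠ 0 := by positivity
  rw [JJ, zpow_neg, zpow_natCast]; field_simp

lemma JJ_rec (T : ℤ → ℝ) (y : ℝ) (hT1 : T (-1) = y/2)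
    (hrec : ∀ n : ℤ, 1 ≤ n → T n ≤ (4*n*(3*n+2)*(3*n-2)/(n+1)) * T (n-2)
        + (4*(3*n+2)/(n+1)) * ∑ k ∈ Finset.Icc (-1 : ℤ) (n-1), T k * T (n-2-k)) :
    ∀ m : ℕ, ∀ n : ℝ, n = m + 2 → JJ T (m+2) ≤ (9*n^2-4)/(9*(n^2-1)) * JJ T m
      + (3*n+2)/(9*(n+1)*n*(n-1)) *
        (∑ k ∈ Finset.range (m+1), JJ T k * JJ T (m-k) / (m.choose k))
      + 2*y*(3*n+2)/(3*n*(n+1)) * JJ T (m+1) := by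
  intro m n hn
  have h := hrec ((m+2:ℕ):ℤ) (by omega)
  rw [show (((m+2:ℕ):ℤ) - 1) = ((m+1:ℕ):ℤ) by omega, int_sum,
    show (((m+2:ℕ):ℤ) - 2) = ((m:ℕ):ℤ) by omega, Finset.sum_range_succ,
    show (m:ℤ) - -1 = ((m+1:ℕ):ℤ) by omega, show (m:ℤ) - ((m+1:ℕ):ℤ) = -1 by omega, hT1] at h
  have hsum : ∑ k ∈ Finset.range (m+1), T k * T ((m:ℤ)-k) =
      m.factorial * 6^m * ∑ k ∈ Finset.range (m+1), JJ T k * JJ T (m-k) / (m.choose k) := by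
    rw [Finset.mul_sum]
    apply Finset.sum_congr rfl
    intro k hk
    rw [Finset.mem_range] at hk
    have hk' : k ≤ m := by omega
    rw [show (m:ℤ) - k = ((m-k:ℕ):ℤ) by omega, T_eq T k, T_eq T (m-k), Nat.cast_choose ℝ hk']
    have a1 : (k.factorial : ℝ) ≠ 0 := by positivity
    have a2 : ((m-k).factorial : ℝ) ≠ 0 := by positivity
    have a3 : (m.factorial : ℝ) ≠ 0 := by positivity
    have : (6:ℝ)^m = 6^k * 6^(m-k) := by rw [← pow_add]; congr 1; omega
    rw [this]
    field_simp
  rw [hsum, T_eq T (m+2), T_eq T (m+1), T_eq T m, Nat.factorial_succ (m+1), Nat.factorial_succ m] at h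
  have hcast : (((m+2:ℕ):ℤ):ℝ) = n := by rw [hn]; push_cast; ring
  rw [hcast] at h
  have c1 : (((m+1+1:ℕ)):ℝ) = n := by rw [hn]; push_cast; ring
  have c2 : (((m+1:ℕ)):ℝ) = n - 1 := by rw [hn]; push_cast; ring
  push_cast at h c1 c2
  rw [c1, c2, pow_succ, pow_succ] at h
  set S := ∑ k ∈ Finset.range (m+1), JJ T k * JJ T (m-k) / (m.choose k)
  have hF : (0:ℝ) < m.factorial * 6^m := by positivity
  have hm0 : (0:ℝ) ≤ m := by positivity
  have e1 : 0 < n - 1 := by linarith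
  have e4 : 0 < n + 1 := by linarith
  have e5 : 0 < n := by linarith
  have e6 : n^2 - 1 = (n-1)*(n+1) := by ring
  have hP : 0 < 36 * n * (n-1) * (m.factorial * 6^m : ℝ) := by positivity
  rw [← mul_le_mul_iff_right₀ hP]
  rw [e6]
  refine le_trans (le_of_eq ?_) (h.trans (le_of_eq ?_))
  · ring
  · field_simp
    ring



/-- For `n ≥ 2` and `0 ≤ y ≤ 2`, `h_n(y) = n^{-y} J_n(y) ≤ 9n`, where
`J_n(y) = (1/n!) 6^{-n} ∑_{g=0}^{n} H(n,g) y^{n+2-2g}`. -/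
theorem h_le_nine_n
    (H : ℤ → ℤ → ℚ)
    (hH1 : ∀ g : ℤ, H (-1) g = if g = 0 then 1/2 else 0)
    (hH2 : ∀ g : ℤ, H 0 g = if g = 0 then 2 else 0)
    (hH3 : ∀ n g : ℤ, g < 0 → H n g = 0)
    (hHrec : ∀ n g : ℤ, 1 ≤ n → 0 ≤ g →
      H n g = (4*n*(3*n+2)*(3*n-2)/(n+1)) * H (n-2) (g-1)
        + (4*(3*n+2)/(n+1)) *
          ∑ k ∈ Finset.Icc (-1 : ℤ) (n-1), ∑ i ∈ Finset.Icc (0 : ℤ) g,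
            H k i * H (n-2-k) (g-i)) :
    ∀ n : ℕ, 2 ≤ n → ∀ y : ℝ, 0 ≤ y → y ≤ 2 →
      (n : ℝ) ^ (-y) *
          ((Nat.factorial n : ℝ)⁻¹ * (6 : ℝ) ^ (-(n : ℤ)) *
            ∑ g ∈ Finset.Icc (0 : ℤ) (n : ℤ),
              ((H (n : ℤ) g : ℚ) : ℝ) * y ^ ((n : ℤ) + 2 - 2 * g))
        ≤ 9 * n := by
  intro n hn y hy hy2
  have hpos : ∀ k : ℤ, -1 ≤ k → ∀ g, 0 ≤ H k g := by
    intro k hk g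
    have := H_nonneg H hH1 hH2 hH3 hHrec (k+1).toNat g
    rwa [show (((k+1).toNat : ℕ):ℤ) - 1 = k by omega] at this
  rcases hy.eq_or_lt with h0 | hy0
  · subst h0
    rw [Finset.sum_eq_zero]
    · rw [mul_zero, mul_zero]; positivity
    · intro g hg
      by_cases he : (n:ℤ) + 2 - 2*g = 0
      · have := H_vanish H hH1 hH2 hHrec (n+1) g (by push_cast; omega)
        rw [show ((n+1:ℕ):ℤ) - 1 = n by push_cast; ring] at this
        rw [this]; simp
      · rw [zero_zpow _ he, mul_zero]
  · obtain ⟨T, hT⟩ : ∃ T : ℤ → ℝ, T = TT H y n := ⟨_, rfl⟩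
    have hTrec : ∀ n : ℤ, 1 ≤ n → T n ≤ (4*n*(3*n+2)*(3*n-2)/(n+1)) * T (n-2)
        + (4*(3*n+2)/(n+1)) * ∑ k ∈ Finset.Icc (-1 : ℤ) (n-1), T k * T (n-2-k) := by
      intro k hk
      rw [hT]
      exact TT_rec H hH3 hHrec hpos y hy0 n k hk
    have hTm : T (-1) = y/2 := by
      rw [hT, TT, Finset.sum_eq_single_of_mem 0 (by simp)]
      · rw [hH1, if_pos rfl]; norm_num; ring
      · intro b _ hb; rw [hH1, if_neg hb]; simp
    have hT0 : T 0 = 2*y^2 := by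
      rw [hT, TT, Finset.sum_eq_single_of_mem 0 (by simp)]
      · rw [hH2, if_pos rfl]; norm_num
      · intro b _ hb; rw [hH2, if_neg hb]; simp
    have hTn : ∀ k : ℕ, 0 ≤ T k := by
      intro k
      rw [hT, TT]
      apply Finset.sum_nonneg
      intro g _
      exact mul_nonneg (by exact_mod_cast hpos k (by omega) g) (zpow_nonneg hy _)
    have hJn : ∀ k, 0 ≤ JJ T k := fun k => by
      unfold JJ
      exact mul_nonneg (by positivity) (hTn k)
    have hJ0 : JJ T 0 = 2*y^2 := by simp [JJ, hT0]
    have hJ1 : JJ T 1 ≤ 5/6*y + 10/3*y^3 := by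
      have h := hTrec 1 le_rfl
      have h2 : ∑ k ∈ Finset.Icc (-1 : ℤ) (1-1), T k * T (1-2-k) = 2 * ((y/2) * (2*y^2)) := by
        have := int_sum (fun k => T k * T (1-2-k)) 0
        norm_num at this
        norm_num
        rw [this, hTm, hT0]; ring
      rw [h2] at h
      norm_num [hTm] at h
      simp only [JJ]
      norm_num
      nlinarith
    have hz1 : (1:ℝ) ≤ 2 ^ y := Real.one_le_rpow (by norm_num) hy
    have hz4 : (2:ℝ) ^ y ≤ 4 := by
      have := Real.rpow_le_rpow_of_exponent_le (by norm_num : (1:ℝ) ≤ 2) hy2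
      norm_num at this
      exact this
    have hzy : 2.8*y - 1.6 ≤ (2:ℝ) ^ y := by
      have e : (2:ℝ)^y = 4 * (2:ℝ) ^ (y-2) := by
        rw [Real.rpow_sub (by norm_num)]; norm_num; ring
      have h2 : Real.log 2 * (y-2) + 1 ≤ (2:ℝ) ^ (y-2) := by
        rw [Real.rpow_def_of_pos (by norm_num)]
        exact Real.add_one_le_exp _
      have h3 := Real.log_two_lt_d9
      have h4 : 0.7 * (y-2) ≤ Real.log 2 * (y-2) :=
        mul_le_mul_of_nonpos_right (by linarith) (by linarith)
      rw [e]; linarith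
    have main := core y (18 * 2^y) (JJ T) hy hy2 (by linarith) (by linarith) (by linarith)
      hJn hJ0 hJ1 (JJ_rec T y hTm hTrec) n hn
    have hf := ff_le_rpow y hy n hn
    have hn0 : (0:ℝ) < n := by exact_mod_cast (by omega : 0 < n)
    have hexp : JJ T n = ((Nat.factorial n : ℝ)⁻¹ * (6 : ℝ) ^ (-(n : ℤ)) *
            ∑ g ∈ Finset.Icc (0 : ℤ) (n : ℤ),
              ((H (n : ℤ) g : ℚ) : ℝ) * y ^ ((n : ℤ) + 2 - 2 * g)) := by
      rw [JJ, hT, TT]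
    rw [← hexp]
    have hb : JJ T n ≤ 18 * 2^y * ((n:ℝ)/2) ^ (1+y) :=
      main.trans (mul_le_mul_of_nonneg_left hf (by positivity))
    calc (n:ℝ) ^ (-y) * JJ T n ≤ (n:ℝ) ^ (-y) * (18 * 2^y * ((n:ℝ)/2) ^ (1+y)) :=
          mul_le_mul_of_nonneg_left hb (by positivity)
      _ = 9 * n := by
          have p1 : (0:ℝ) < (n:ℝ)^y := by positivity
          have p2 : (0:ℝ) < (2:ℝ)^y := by positivity
          rw [Real.div_rpow hn0.le (by norm_num), Real.rpow_neg hn0.le, Real.rpow_add hn0,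
            Real.rpow_add (by norm_num), Real.rpow_one, Real.rpow_one]
          field_simp
          norm_num
end
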